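/- Let H be a regular central triangular galaxy under an ordering θ with |H| = h, and let K under β be the key tournament corresponding to H under θ. Let 0 < λ < 1/(4h)^{h+4} and c > 0 be constants, and let w be the {0,1}-vector for which a smooth (c,λ,w)-structure corresponds to K under β. Then there exists ε_0 > 0 such that for every 0 < ε < ε_0, every ε-critical tournament T that contains a smooth (c,λ,w)-structure corresponding to K under β contains H or contains K_6. -/

import Mathlib

open Finset

/-- A tournament on vertex set `Fin n`: `adj u v` means there is an arc from `u` to `v`. -/
structure Tournament (n : ℕ) where
  adj : Fin n → Fin n → Prop
  asymm : ∀ u v, adj u v → ¬ adj v u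
  total : ∀ u v, u ≠ v → adj u v ∨ adj v u

namespace Tournament

variable {n N : ℕ}

/-- The position of vertex `v` in the ordering `θ`, where `θ k` is the `k`-th vertex. -/
def pos (θ : Equiv.Perm (Fin n)) (v : Fin n) : Fin n := θ.symm v

/-- The arc `u → v` of `T` is a backward arc under the ordering `θ`. -/
def Backward (T : Tournament n) (θ : Equiv.Perm (Fin n)) (u v : Fin n) : Prop :=
  T.adj u v ∧ pos θ v < pos θ u

/-- `x` lies strictly between two elements of `L` under the ordering `θ`. -/
def BetweenSet (θ : Equiv.Perm (Fin n)) (L : Finset (Fin n)) (x : Fin n) : Prop :=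
  ∃ u ∈ L, ∃ w ∈ L, pos θ u < pos θ x ∧ pos θ x < pos θ w

/-- The induced subtournament of `T` on `s` is transitive. -/
def IsTransOn (T : Tournament n) (s : Finset (Fin n)) : Prop :=
  ∀ u ∈ s, ∀ v ∈ s, ∀ w ∈ s, T.adj u v → T.adj v w → T.adj u w

/-- The largest size of a transitive subtournament of `T` contained in `s`. -/
noncomputable def trSizeOn (T : Tournament n) (s : Finset (Fin n)) : ℕ :=
  sSup {k | ∃ t, t ⊆ s ∧ T.IsTransOn t ∧ t.card = k}

/-- `tr(T)`: the largest size of a transitive subtournament of `T`. -/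
noncomputable def trSize (T : Tournament n) : ℕ := T.trSizeOn Finset.univ

/-- `T` contains `H`: some induced subtournament of `T` is isomorphic to `H`. -/
def Contains (T : Tournament N) (H : Tournament n) : Prop :=
  ∃ f : Fin n ↪ Fin N, ∀ u v, H.adj u v ↔ T.adj (f u) (f v)

/-- `T` is `ε`-critical. -/
def EpsCritical (T : Tournament n) (ε : ℝ) : Prop :=
  ((T.trSize : ℝ) < (n : ℝ) ^ ε) ∧
  ∀ s : Finset (Fin n), s ≠ Finset.univ → ((s.card : ℝ) ^ ε ≤ (T.trSizeOn s : ℝ))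

/-- `S` with center `c` is a right star of `T` under `θ`. -/
def IsRightStarAt (T : Tournament n) (θ : Equiv.Perm (Fin n)) (S : Finset (Fin n))
    (c : Fin n) : Prop :=
  c ∈ S ∧ (S.erase c).Nonempty ∧
  (∀ v ∈ S.erase c, pos θ v < pos θ c ∧ T.adj c v) ∧
  (∀ u ∈ S, ∀ v ∈ S, T.Backward θ u v → u = c)

/-- `S` with center `c` is a left star of `T` under `θ`. -/
def IsLeftStarAt (T : Tournament n) (θ : Equiv.Perm (Fin n)) (S : Finset (Fin n))
    (c : Fin n) : Prop :=
  c ∈ S ∧ (S.erase c).Nonempty ∧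
  (∀ v ∈ S.erase c, pos θ c < pos θ v ∧ T.adj v c) ∧
  (∀ u ∈ S, ∀ v ∈ S, T.Backward θ u v → v = c)

/-- `S` with center `c` is a middle star of `T` under `θ`. -/
def IsMiddleStarAt (T : Tournament n) (θ : Equiv.Perm (Fin n)) (S : Finset (Fin n))
    (c : Fin n) : Prop :=
  c ∈ S ∧
  (∃ v ∈ S.erase c, pos θ v < pos θ c) ∧ (∃ v ∈ S.erase c, pos θ c < pos θ v) ∧
  (∀ v ∈ S.erase c, (pos θ v < pos θ c → T.adj c v) ∧ (pos θ c < pos θ v → T.adj v c)) ∧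
  (∀ u ∈ S, ∀ v ∈ S, T.Backward θ u v → u = c ∨ v = c)

def IsFrontierStarAt (T : Tournament n) (θ : Equiv.Perm (Fin n)) (S : Finset (Fin n))
    (c : Fin n) : Prop :=
  T.IsLeftStarAt θ S c ∨ T.IsRightStarAt θ S c

def IsStarAt (T : Tournament n) (θ : Equiv.Perm (Fin n)) (S : Finset (Fin n))
    (c : Fin n) : Prop :=
  T.IsLeftStarAt θ S c ∨ T.IsRightStarAt θ S c ∨ T.IsMiddleStarAt θ S c

/-- A middle star with exactly one leaf after the center (center is `u_{p-1}`). -/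
def IsOneRightMiddleStarAt (T : Tournament n) (θ : Equiv.Perm (Fin n)) (S : Finset (Fin n))
    (c : Fin n) : Prop :=
  T.IsMiddleStarAt θ S c ∧ ((S.erase c).filter (fun v => pos θ c < pos θ v)).card = 1

/-- A middle star with exactly one leaf before the center (center is `u_2`). -/
def IsOneLeftMiddleStarAt (T : Tournament n) (θ : Equiv.Perm (Fin n)) (S : Finset (Fin n))
    (c : Fin n) : Prop :=
  T.IsMiddleStarAt θ S c ∧ ((S.erase c).filter (fun v => pos θ v < pos θ c)).card = 1

/-- Kinds of super 2-nebulas. -/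
inductive NebKind
  | left
  | middle
  | right

/-- Common requirements on the data of a super 2-nebula: vertex set `S`, centers `c₁, c₂`
(`c₁` before `c₂` under `θ`), leaves `L₁` incident to `c₁` and `L₂` incident to `c₂`. -/
def Super2NebCommon (θ : Equiv.Perm (Fin n)) (S : Finset (Fin n)) (c₁ c₂ : Fin n)
    (L₁ L₂ : Finset (Fin n)) : Prop :=
  L₁.Nonempty ∧ L₂.Nonempty ∧ Disjoint L₁ L₂ ∧
  c₁ ∉ L₁ ∪ L₂ ∧ c₂ ∉ L₁ ∪ L₂ ∧ c₁ ≠ c₂ ∧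
  S = insert c₁ (insert c₂ (L₁ ∪ L₂)) ∧ pos θ c₁ < pos θ c₂

/-- `S` is a super (left/middle/right) 2-nebula of `T` under `θ`, with centers `c₁, c₂` and
leaves `L₁` (incident to `c₁`) and `L₂` (incident to `c₂`). -/
def IsSuper2NebulaAt (T : Tournament n) (θ : Equiv.Perm (Fin n)) (S : Finset (Fin n))
    (c₁ c₂ : Fin n) (L₁ L₂ : Finset (Fin n)) : NebKind → Prop
  | NebKind.middle =>
      Super2NebCommon θ S c₁ c₂ L₁ L₂ ∧
      (∀ v ∈ L₁ ∪ L₂, pos θ c₁ < pos θ v ∧ pos θ v < pos θ c₂) ∧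
      (∀ v ∈ L₁, T.adj v c₁) ∧ (∀ v ∈ L₂, T.adj c₂ v) ∧ T.adj c₂ c₁ ∧
      (∀ u ∈ S, ∀ v ∈ S, T.Backward θ u v →
        (u ∈ L₁ ∧ v = c₁) ∨ (u = c₂ ∧ v ∈ L₂) ∨ (u = c₂ ∧ v = c₁))
  | NebKind.left =>
      Super2NebCommon θ S c₁ c₂ L₁ L₂ ∧
      (∀ v ∈ L₁ ∪ L₂, pos θ v < pos θ c₁) ∧
      (∀ v ∈ L₁, T.adj c₁ v) ∧ (∀ v ∈ L₂, T.adj c₂ v) ∧ T.adj c₂ c₁ ∧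
      (∀ u ∈ S, ∀ v ∈ S, T.Backward θ u v →
        (u = c₁ ∧ v ∈ L₁) ∨ (u = c₂ ∧ v ∈ L₂) ∨ (u = c₂ ∧ v = c₁))
  | NebKind.right =>
      Super2NebCommon θ S c₁ c₂ L₁ L₂ ∧
      (∀ v ∈ L₁ ∪ L₂, pos θ c₂ < pos θ v) ∧
      (∀ v ∈ L₁, T.adj v c₁) ∧ (∀ v ∈ L₂, T.adj v c₂) ∧ T.adj c₂ c₁ ∧
      (∀ u ∈ S, ∀ v ∈ S, T.Backward θ u v →
        (u ∈ L₁ ∧ v = c₁) ∨ (u ∈ L₂ ∧ v = c₂) ∨ (u = c₂ ∧ v = c₁))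

/-- A decomposition of `T` witnessing that `T` is a super nebula under `θ`, with stars
`Q i` (centers `ctr i`) and super 2-nebulas `Sig i` (centers `c₁ i, c₂ i`, leaves
`L₁ i, L₂ i`, of kind `kd i`). -/
def SuperNebulaDecomp (T : Tournament n) (θ : Equiv.Perm (Fin n)) {m l : ℕ}
    (Q : Fin m → Finset (Fin n)) (ctr : Fin m → Fin n)
    (Sig : Fin l → Finset (Fin n)) (c₁ c₂ : Fin l → Fin n)
    (L₁ L₂ : Fin l → Finset (Fin n)) (kd : Fin l → NebKind) : Prop :=
  (∀ i, T.IsStarAt θ (Q i) (ctr i)) ∧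
  (∀ i, T.IsSuper2NebulaAt θ (Sig i) (c₁ i) (c₂ i) (L₁ i) (L₂ i) (kd i)) ∧
  (∀ i j, i ≠ j → Disjoint (Q i) (Q j)) ∧
  (∀ i j, i ≠ j → Disjoint (Sig i) (Sig j)) ∧
  (∀ i j, Disjoint (Q i) (Sig j)) ∧
  (∀ u v, T.Backward θ u v → (∃ i, u ∈ Q i ∧ v ∈ Q i) ∨ (∃ i, u ∈ Sig i ∧ v ∈ Sig i)) ∧
  (∀ i j, ¬ BetweenSet θ (L₁ j ∪ L₂ j) (ctr i)) ∧
  (∀ i j, i ≠ j → ¬ BetweenSet θ (L₁ j ∪ L₂ j) (c₁ i) ∧ ¬ BetweenSet θ (L₁ j ∪ L₂ j) (c₂ i))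

/-- `T` is a super nebula. -/
def IsSuperNebula (T : Tournament n) : Prop :=
  ∃ (θ : Equiv.Perm (Fin n)) (m l : ℕ) (Q : Fin m → Finset (Fin n)) (ctr : Fin m → Fin n)
    (Sig : Fin l → Finset (Fin n)) (c₁ c₂ : Fin l → Fin n)
    (L₁ L₂ : Fin l → Finset (Fin n)) (kd : Fin l → NebKind),
    SuperNebulaDecomp T θ Q ctr Sig c₁ c₂ L₁ L₂ kd

/-- `{a, b, c}` (in this position order) is a triangle of `T` under `θ`:
`a` is the left exterior, `b` the center, `c` the right exterior. -/
def IsTriangleAt (T : Tournament n) (θ : Equiv.Perm (Fin n)) (a b c : Fin n) : Prop :=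
  pos θ a < pos θ b ∧ pos θ b < pos θ c ∧ T.adj b a ∧ T.adj c a ∧ T.adj c b

/-- A decomposition of `T` under `θ` into triangles `{A i, B i, C i}` (left exterior, center,
right exterior) and frontier stars `Q j` with centers `ctr j`, where for each triangle `i`,
the vertices in `forb i` are not allowed to lie between leaves of a star. -/
def TriGalaxyDecomp (T : Tournament n) (θ : Equiv.Perm (Fin n)) {l k : ℕ}
    (A B C : Fin l → Fin n) (Q : Fin k → Finset (Fin n)) (ctr : Fin k → Fin n)
    (forb : Fin l → Finset (Fin n)) : Prop :=
  (∀ i, T.IsTriangleAt θ (A i) (B i) (C i)) ∧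
  (∀ j, T.IsFrontierStarAt θ (Q j) (ctr j)) ∧
  (∀ i j, i ≠ j →
    Disjoint ({A i, B i, C i} : Finset (Fin n)) ({A j, B j, C j} : Finset (Fin n))) ∧
  (∀ i j, Disjoint ({A i, B i, C i} : Finset (Fin n)) (Q j)) ∧
  (∀ i j, i ≠ j → Disjoint (Q i) (Q j)) ∧
  (∀ u v, T.Backward θ u v →
    (∃ i, u ∈ ({A i, B i, C i} : Finset (Fin n)) ∧ v ∈ ({A i, B i, C i} : Finset (Fin n))) ∨
    (∃ j, u ∈ Q j ∧ v ∈ Q j)) ∧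
  (∀ i j, i ≠ j → ¬ BetweenSet θ ((Q j).erase (ctr j)) (ctr i)) ∧
  (∀ i j, ∀ x ∈ forb i, ¬ BetweenSet θ ((Q j).erase (ctr j)) x)

/-- `T` is a Δgalaxy: a triangular galaxy with exactly one triangle. -/
def IsDeltaGalaxy (T : Tournament n) : Prop :=
  ∃ (θ : Equiv.Perm (Fin n)) (a b c : Fin n) (k : ℕ)
    (Q : Fin k → Finset (Fin n)) (ctr : Fin k → Fin n),
    TriGalaxyDecomp T θ (fun _ : Fin 1 => a) (fun _ => b) (fun _ => c) Q ctr
      (fun _ => ({a, b, c} : Finset (Fin n)))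

/-- `T` is a central triangular galaxy: centers of triangles may lie between leaves of stars. -/
def IsCentralTriangularGalaxy (T : Tournament n) : Prop :=
  ∃ (θ : Equiv.Perm (Fin n)) (l k : ℕ) (A B C : Fin l → Fin n)
    (Q : Fin k → Finset (Fin n)) (ctr : Fin k → Fin n),
    TriGalaxyDecomp T θ A B C Q ctr (fun i => ({A i, C i} : Finset (Fin n)))

/-- `T` is a left triangular galaxy: left exteriors of triangles may lie between leaves. -/
def IsLeftTriangularGalaxy (T : Tournament n) : Prop :=
  ∃ (θ : Equiv.Perm (Fin n)) (l k : ℕ) (A B C : Fin l → Fin n)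
    (Q : Fin k → Finset (Fin n)) (ctr : Fin k → Fin n),
    TriGalaxyDecomp T θ A B C Q ctr (fun i => ({B i, C i} : Finset (Fin n)))

/-- `T` is a right triangular galaxy: right exteriors of triangles may lie between leaves. -/
def IsRightTriangularGalaxy (T : Tournament n) : Prop :=
  ∃ (θ : Equiv.Perm (Fin n)) (l k : ℕ) (A B C : Fin l → Fin n)
    (Q : Fin k → Finset (Fin n)) (ctr : Fin k → Fin n),
    TriGalaxyDecomp T θ A B C Q ctr (fun i => ({A i, B i} : Finset (Fin n)))

/-- A decomposition of `T` witnessing that `T` is a nebula under `θ` (no condition on the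
location of the centers of the stars). -/
def NebulaDecomp (T : Tournament n) (θ : Equiv.Perm (Fin n)) {k : ℕ}
    (Q : Fin k → Finset (Fin n)) (ctr : Fin k → Fin n) : Prop :=
  (∀ i, T.IsStarAt θ (Q i) (ctr i)) ∧
  (∀ i j, i ≠ j → Disjoint (Q i) (Q j)) ∧
  (∀ u v, T.Backward θ u v → ∃ i, u ∈ Q i ∧ v ∈ Q i)

/-- `T` is a central nebula: a nebula all of whose stars are 3-vertex middle stars. -/
def IsCentralNebula (T : Tournament n) : Prop :=
  ∃ (θ : Equiv.Perm (Fin n)) (k : ℕ) (Q : Fin k → Finset (Fin n)) (ctr : Fin k → Fin n),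
    NebulaDecomp T θ Q ctr ∧ ∀ i, T.IsMiddleStarAt θ (Q i) (ctr i) ∧ (Q i).card = 3

/-- `T` is a super left nebula: a nebula all of whose stars are left stars. -/
def IsSuperLeftNebula (T : Tournament n) : Prop :=
  ∃ (θ : Equiv.Perm (Fin n)) (k : ℕ) (Q : Fin k → Finset (Fin n)) (ctr : Fin k → Fin n),
    NebulaDecomp T θ Q ctr ∧ ∀ i, T.IsLeftStarAt θ (Q i) (ctr i)

/-- `T` is a super right nebula: a nebula all of whose stars are right stars. -/
def IsSuperRightNebula (T : Tournament n) : Prop :=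
  ∃ (θ : Equiv.Perm (Fin n)) (k : ℕ) (Q : Fin k → Finset (Fin n)) (ctr : Fin k → Fin n),
    NebulaDecomp T θ Q ctr ∧ ∀ i, T.IsRightStarAt θ (Q i) (ctr i)

/-- `T` is an LR-Δgalaxy: a super Δgalaxy in which only the two exteriors of the triangle
may lie between leaves of a star. -/
def IsLRDeltaGalaxy (T : Tournament n) : Prop :=
  ∃ (θ : Equiv.Perm (Fin n)) (a b c : Fin n) (k : ℕ)
    (Q : Fin k → Finset (Fin n)) (ctr : Fin k → Fin n),
    TriGalaxyDecomp T θ (fun _ : Fin 1 => a) (fun _ => b) (fun _ => c) Q ctr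
      (fun _ => ({b} : Finset (Fin n)))

/-- `T` is a CR-Δgalaxy. -/
def IsCRDeltaGalaxy (T : Tournament n) : Prop :=
  ∃ (θ : Equiv.Perm (Fin n)) (a b c : Fin n) (k : ℕ)
    (Q : Fin k → Finset (Fin n)) (ctr : Fin k → Fin n),
    TriGalaxyDecomp T θ (fun _ : Fin 1 => a) (fun _ => b) (fun _ => c) Q ctr
      (fun _ => ({a} : Finset (Fin n))) ∧
    (∀ i j, i ≠ j → BetweenSet θ ((Q i).erase (ctr i)) b →
      BetweenSet θ ((Q j).erase (ctr j)) c →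
      (∀ x ∈ (Q i).erase (ctr i), ¬ BetweenSet θ ((Q j).erase (ctr j)) x) ∧
      (∀ x ∈ (Q j).erase (ctr j), ¬ BetweenSet θ ((Q i).erase (ctr i)) x)) ∧
    (∀ i, BetweenSet θ ((Q i).erase (ctr i)) b → ¬ BetweenSet θ ((Q i).erase (ctr i)) c)

/-- `T` is a CL-Δgalaxy. -/
def IsCLDeltaGalaxy (T : Tournament n) : Prop :=
  ∃ (θ : Equiv.Perm (Fin n)) (a b c : Fin n) (k : ℕ)
    (Q : Fin k → Finset (Fin n)) (ctr : Fin k → Fin n),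
    TriGalaxyDecomp T θ (fun _ : Fin 1 => a) (fun _ => b) (fun _ => c) Q ctr
      (fun _ => ({c} : Finset (Fin n))) ∧
    (∀ i j, i ≠ j → BetweenSet θ ((Q i).erase (ctr i)) b →
      BetweenSet θ ((Q j).erase (ctr j)) a →
      (∀ x ∈ (Q i).erase (ctr i), ¬ BetweenSet θ ((Q j).erase (ctr j)) x) ∧
      (∀ x ∈ (Q j).erase (ctr j), ¬ BetweenSet θ ((Q i).erase (ctr i)) x)) ∧
    (∀ i, BetweenSet θ ((Q i).erase (ctr i)) b → ¬ BetweenSet θ ((Q i).erase (ctr i)) a)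

/-- A decomposition of `T` under `θ` into one super 2-nebula (of kind `kd`) and frontier
stars, covering all of `V(T)`, witnessing that `T` is a Σ-galaxy under `θ`. -/
def SigmaGalaxyDecomp (T : Tournament n) (θ : Equiv.Perm (Fin n))
    (S : Finset (Fin n)) (c₁ c₂ : Fin n) (L₁ L₂ : Finset (Fin n)) (kd : NebKind)
    {m : ℕ} (Q : Fin m → Finset (Fin n)) (ctr : Fin m → Fin n) : Prop :=
  T.IsSuper2NebulaAt θ S c₁ c₂ L₁ L₂ kd ∧
  (∀ j, T.IsFrontierStarAt θ (Q j) (ctr j)) ∧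
  (∀ i j, i ≠ j → Disjoint (Q i) (Q j)) ∧
  (∀ j, Disjoint S (Q j)) ∧
  (∀ v, v ∈ S ∨ ∃ j, v ∈ Q j) ∧
  (∀ u v, T.Backward θ u v → (u ∈ S ∧ v ∈ S) ∨ ∃ j, u ∈ Q j ∧ v ∈ Q j) ∧
  (∀ j, ¬ BetweenSet θ (L₁ ∪ L₂) (ctr j)) ∧
  (∀ j, ¬ BetweenSet θ ((Q j).erase (ctr j)) c₁ ∧ ¬ BetweenSet θ ((Q j).erase (ctr j)) c₂) ∧
  (∀ i j, i ≠ j → ¬ BetweenSet θ ((Q j).erase (ctr j)) (ctr i))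

def IsMiddleSigmaGalaxy (T : Tournament n) : Prop :=
  ∃ (θ : Equiv.Perm (Fin n)) (S : Finset (Fin n)) (c₁ c₂ : Fin n) (L₁ L₂ : Finset (Fin n))
    (m : ℕ) (Q : Fin m → Finset (Fin n)) (ctr : Fin m → Fin n),
    SigmaGalaxyDecomp T θ S c₁ c₂ L₁ L₂ NebKind.middle Q ctr

def IsLeftSigmaGalaxy (T : Tournament n) : Prop :=
  ∃ (θ : Equiv.Perm (Fin n)) (S : Finset (Fin n)) (c₁ c₂ : Fin n) (L₁ L₂ : Finset (Fin n))
    (m : ℕ) (Q : Fin m → Finset (Fin n)) (ctr : Fin m → Fin n),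
    SigmaGalaxyDecomp T θ S c₁ c₂ L₁ L₂ NebKind.left Q ctr

def IsRightSigmaGalaxy (T : Tournament n) : Prop :=
  ∃ (θ : Equiv.Perm (Fin n)) (S : Finset (Fin n)) (c₁ c₂ : Fin n) (L₁ L₂ : Finset (Fin n))
    (m : ℕ) (Q : Fin m → Finset (Fin n)) (ctr : Fin m → Fin n),
    SigmaGalaxyDecomp T θ S c₁ c₂ L₁ L₂ NebKind.right Q ctr

/-- The directed density from `X` to `Y`. -/
noncomputable def density (T : Tournament n) (X Y : Finset (Fin n)) : ℝ :=
  (Set.ncard {p : Fin n × Fin n | p.1 ∈ X ∧ p.2 ∈ Y ∧ T.adj p.1 p.2} : ℝ) /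
    ((X.card : ℝ) * (Y.card : ℝ))

/-- `(S i)` is a smooth `(c, lam, w)`-structure of `T`. -/
def IsSmoothStructure (T : Tournament n) (c lam : ℝ) {N : ℕ} (w : Fin N → Bool)
    (S : Fin N → Finset (Fin n)) : Prop :=
  (∀ i j, i ≠ j → Disjoint (S i) (S j)) ∧
  (∀ i, w i = false → c * (n : ℝ) ≤ ((S i).card : ℝ)) ∧
  (∀ i, w i = true → T.IsTransOn (S i) ∧ c * (T.trSize : ℝ) ≤ ((S i).card : ℝ)) ∧
  (∀ i j, i < j →
    (∀ v ∈ S i, 1 - lam ≤ T.density {v} (S j)) ∧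
    (∀ v ∈ S j, 1 - lam ≤ T.density (S i) {v}))

end Tournament

/-- The backward arcs of `K₆` under its canonical ordering. -/
def K6back : List (ℕ × ℕ) := [(3, 0), (5, 2), (5, 0), (4, 1)]

/-- The tournament `K₆`, on `Fin 6` with its canonical ordering. -/
def K6 : Tournament 6 where
  adj u v := (u.val, v.val) ∈ K6back ∨ (u < v ∧ (v.val, u.val) ∉ K6back)
  asymm := by decide
  total := by decide

/-- The pair `{H₁, H₂}` satisfies the Erdős–Hajnal conjecture: there is `ε > 0` such that
every `{H₁, H₂}`-free tournament `T` has a transitive subtournament of size `≥ |T| ^ ε`. -/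
def EHPair {n₁ n₂ : ℕ} (H₁ : Tournament n₁) (H₂ : Tournament n₂) : Prop :=
  ∃ ε : ℝ, 0 < ε ∧ ∀ (n : ℕ) (T : Tournament n),
    ¬ T.Contains H₁ → ¬ T.Contains H₂ → (n : ℝ) ^ ε ≤ (T.trSize : ℝ)

namespace Tournament

/-- The vertex set of a `K₆` of a tournament under an ordering `β`, given by its
(increasing) positions `q 0 < … < q 5`. -/
def k6verts {fz : ℕ} (β : Equiv.Perm (Fin fz)) (q : Fin 6 → Fin fz) : Finset (Fin fz) :=
  Finset.univ.image (fun a => β (q a))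

/-- The vertices at the (increasing) positions `q 0, …, q 5` form a `K₆` of `K` under `β`:
consecutive positions `q 1 = q 0 + 1`, `q 3 = q 2 + 1`, `q 5 = q 4 + 1`, and the induced
subtournament is isomorphic to `K₆` with `(β (q 0), …, β (q 5))` as its canonical ordering. -/
def IsK6At {fz : ℕ} (K : Tournament fz) (β : Equiv.Perm (Fin fz)) (q : Fin 6 → Fin fz) : Prop :=
  StrictMono q ∧
  (q 1).val = (q 0).val + 1 ∧ (q 3).val = (q 2).val + 1 ∧ (q 5).val = (q 4).val + 1 ∧
  (∀ a b : Fin 6, K6.adj a b ↔ K.adj (β (q a)) (β (q b)))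

/-- `K` is a `GK₆` under `β`, with `K₆`'s given by the position tuples `q i` and with the
stars `Q j` (centers `ctr j`) forming a regular galaxy on the remaining vertices. -/
def GK6Decomp {fz : ℕ} (K : Tournament fz) (β : Equiv.Perm (Fin fz)) {l k : ℕ}
    (q : Fin l → Fin 6 → Fin fz) (Q : Fin k → Finset (Fin fz)) (ctr : Fin k → Fin fz) : Prop :=
  (∀ i, IsK6At K β (q i)) ∧
  (∀ j, K.IsFrontierStarAt β (Q j) (ctr j)) ∧
  (∀ i j, i ≠ j → Disjoint (k6verts β (q i)) (k6verts β (q j))) ∧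
  (∀ i j, Disjoint (k6verts β (q i)) (Q j)) ∧
  (∀ i j, i ≠ j → Disjoint (Q i) (Q j)) ∧
  (∀ v, (∃ i, v ∈ k6verts β (q i)) ∨ (∃ j, v ∈ Q j)) ∧
  (∀ u v, K.Backward β u v →
    (∃ i, u ∈ k6verts β (q i) ∧ v ∈ k6verts β (q i)) ∨ (∃ j, u ∈ Q j ∧ v ∈ Q j)) ∧
  (∀ i j, i ≠ j → ¬ BetweenSet β ((Q j).erase (ctr j)) (ctr i)) ∧
  (∀ i j, ¬ BetweenSet β ((Q j).erase (ctr j)) (β (q i 0)) ∧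
          ¬ BetweenSet β ((Q j).erase (ctr j)) (β (q i 5)))

/-- `K` under `β` (a `GK₆` with `K₆`'s at `q i`) is the key tournament corresponding to `H`
under `θ`: performing, on every `K₆` of `K` under `β`, the operation that deletes its second,
third and fifth vertices and reverses the arc between its fourth and sixth vertices, yields
the tournament `H`, and the ordering obtained from `β` is `θ`.  The map `φ` identifies the
vertices of `H` with the surviving vertices of `K`. -/
def KeyCorr {h fz : ℕ} (H : Tournament h) (θ : Equiv.Perm (Fin h))
    (K : Tournament fz) (β : Equiv.Perm (Fin fz)) {l : ℕ} (q : Fin l → Fin 6 → Fin fz)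
    (φ : Fin h → Fin fz) : Prop :=
  Function.Injective φ ∧
  (∀ u v : Fin h, pos θ u < pos θ v ↔ pos β (φ u) < pos β (φ v)) ∧
  (∀ x : Fin fz, (∃ u, φ u = x) ↔ ∀ i : Fin l, x ≠ β (q i 1) ∧ x ≠ β (q i 2) ∧ x ≠ β (q i 4)) ∧
  (∀ u v : Fin h,
    ((∃ i, (φ u = β (q i 5) ∧ φ v = β (q i 3)) ∨ (φ u = β (q i 3) ∧ φ v = β (q i 5))) →
      (H.adj u v ↔ K.adj (φ v) (φ u))) ∧
    ((¬ ∃ i, (φ u = β (q i 5) ∧ φ v = β (q i 3)) ∨ (φ u = β (q i 3) ∧ φ v = β (q i 5))) →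
      (H.adj u v ↔ K.adj (φ u) (φ v))))

end Tournament

/-- `w` is obtained from `s` by replacing every maximal block of consecutive `true`s
(i.e. `1`s) by a single `true`. -/
def IsContraction {fz Nw : ℕ} (s : Fin fz → Bool) (w : Fin Nw → Bool) : Prop :=
  ∃ ρ : Fin fz → Fin Nw, Monotone ρ ∧ Function.Surjective ρ ∧
    (∀ p, w (ρ p) = s p) ∧
    (∀ p p', ρ p = ρ p' → p ≠ p' → s p = true) ∧
    (∀ (p : Fin fz) (hp : p.val + 1 < fz), s p = true → s ⟨p.val + 1, hp⟩ = true →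
      ρ p = ρ ⟨p.val + 1, hp⟩)

open Tournament

namespace Tournament

section Transitive

variable {n : ℕ}

theorem not_adj_self (T : Tournament n) (u : Fin n) : ¬ T.adj u u :=
  fun h => T.asymm u u h h

theorem contains_of_hom {m : ℕ} (T : Tournament n) (H : Tournament m) (f : Fin m → Fin n)
    (hf : ∀ u v, H.adj u v → T.adj (f u) (f v)) : T.Contains H := by
  have hinj : Function.Injective f := by
    intro u v huv
    by_contra hne
    rcases H.total u v hne with h | h
    · exact T.not_adj_self (f v) (huv ▸ hf u v h)
    · exact T.not_adj_self (f v) (huv ▸ hf v u h)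
  refine ⟨⟨f, hinj⟩, fun u v => ⟨hf u v, fun h => ?_⟩⟩
  have hne : u ≠ v := by
    rintro rfl
    exact T.not_adj_self _ h
  exact (H.total u v hne).resolve_right fun h' => T.asymm _ _ h (hf v u h')

theorem card_le_trSizeOn (T : Tournament n) {t s : Finset (Fin n)} (hts : t ⊆ s)
    (ht : T.IsTransOn t) : t.card ≤ T.trSizeOn s := by
  refine le_csSup ⟨s.card, ?_⟩ ⟨t, hts, ht, rfl⟩
  rintro k ⟨t, h, _, rfl⟩
  exact card_le_card h

theorem exists_transOn_card_eq (T : Tournament n) (s : Finset (Fin n)) :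
    ∃ t, t ⊆ s ∧ T.IsTransOn t ∧ t.card = T.trSizeOn s := by
  refine Nat.sSup_mem (s := {k | ∃ t, t ⊆ s ∧ T.IsTransOn t ∧ t.card = k})
    ⟨0, ∅, empty_subset s, fun u hu => absurd hu (notMem_empty u), rfl⟩ ⟨s.card, ?_⟩
  rintro k ⟨t, h, _, rfl⟩
  exact card_le_card h

theorem IsTransOn.mono {T : Tournament n} {s t : Finset (Fin n)} (hs : T.IsTransOn s)
    (hts : t ⊆ s) : T.IsTransOn t :=
  fun u hu v hv w hw => hs u (hts hu) v (hts hv) w (hts hw)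

theorem IsTransOn.union {T : Tournament n} {A B : Finset (Fin n)} (hA : T.IsTransOn A)
    (hB : T.IsTransOn B) (hAB : ∀ a ∈ A, ∀ b ∈ B, T.adj a b) : T.IsTransOn (A ∪ B) := by
  intro u hu v hv w hw huv hvw
  have h1 := T.asymm u v huv
  have h2 := T.asymm v w hvw
  rcases mem_union.1 hu with hu | hu <;> rcases mem_union.1 hv with hv | hv <;>
    rcases mem_union.1 hw with hw | hw
  · exact hA u hu v hv w hw huv hvw
  · exact hAB u hu w hw
  · exact absurd (hAB w hw v hv) h2
  · exact hAB u hu w hw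
  · exact absurd (hAB v hv u hu) h1
  · exact absurd (hAB v hv u hu) h1
  · exact absurd (hAB w hw v hv) h2
  · exact hB u hu v hv w hw huv hvw

theorem isTransOn_singleton (T : Tournament n) (v : Fin n) : T.IsTransOn {v} := by
  intro u hu w hw x hx h
  rw [mem_singleton.1 hu, mem_singleton.1 hw] at h
  exact absurd h (T.not_adj_self v)

theorem disjoint_of_complete (T : Tournament n) {A B : Finset (Fin n)}
    (hAB : ∀ a ∈ A, ∀ b ∈ B, T.adj a b) : Disjoint A B :=
  disjoint_left.2 fun a ha hb => T.not_adj_self a (hAB a ha a hb)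

theorem trSizeOn_add_le (T : Tournament n) {A B : Finset (Fin n)}
    (hAB : ∀ a ∈ A, ∀ b ∈ B, T.adj a b) : T.trSizeOn A + T.trSizeOn B ≤ T.trSize := by
  obtain ⟨s, hs, hst, hsc⟩ := T.exists_transOn_card_eq A
  obtain ⟨t, ht, htt, htc⟩ := T.exists_transOn_card_eq B
  have hst' : ∀ a ∈ s, ∀ b ∈ t, T.adj a b := fun a ha b hb => hAB a (hs ha) b (ht hb)
  rw [← hsc, ← htc, ← card_union_of_disjoint (T.disjoint_of_complete hst')]
  exact T.card_le_trSizeOn (subset_univ _) (hst.union htt hst')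

theorem exists_transOn_of_two_pow_le (T : Tournament n) (k : ℕ) :
    ∀ s : Finset (Fin n), 2 ^ k ≤ s.card → ∃ t ⊆ s, T.IsTransOn t ∧ k + 1 ≤ t.card := by
  classical
  induction k with
  | zero =>
    intro s hs
    obtain ⟨v, hv⟩ := card_pos.1 (Nat.lt_of_lt_of_le Nat.one_pos hs)
    exact ⟨{v}, singleton_subset_iff.2 hv, T.isTransOn_singleton v, by simp⟩
  | succ k ih =>
    intro s hs
    obtain ⟨v, hv⟩ := card_pos.1 (lt_of_lt_of_le (Nat.two_pow_pos _) hs)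
    have hsub : s.erase v ⊆ s.filter (fun u => T.adj v u) ∪ s.filter (fun u => T.adj u v) := by
      intro u hu
      rw [mem_erase] at hu
      rcases T.total u v hu.1 with h | h <;> simp [hu.2, h]
    have hcard := (card_le_card hsub).trans (card_union_le _ _)
    rw [card_erase_of_mem hv] at hcard
    have hor : 2 ^ k ≤ (s.filter (fun u => T.adj v u)).card ∨
        2 ^ k ≤ (s.filter (fun u => T.adj u v)).card := by
      rw [pow_succ] at hs
      omega
    rcases hor with h | h
    · obtain ⟨t, hts, ht, htc⟩ := ih _ h
      have hcomp : ∀ a ∈ ({v} : Finset (Fin n)), ∀ b ∈ t, T.adj a b := fun a ha b hb => by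
        rw [mem_singleton.1 ha]
        exact (mem_filter.1 (hts hb)).2
      refine ⟨{v} ∪ t, union_subset (singleton_subset_iff.2 hv)
        (hts.trans (filter_subset _ _)), (T.isTransOn_singleton v).union ht hcomp, ?_⟩
      rw [card_union_of_disjoint (T.disjoint_of_complete hcomp), card_singleton]
      omega
    · obtain ⟨t, hts, ht, htc⟩ := ih _ h
      have hcomp : ∀ a ∈ t, ∀ b ∈ ({v} : Finset (Fin n)), T.adj a b := fun a ha b hb => by
        rw [mem_singleton.1 hb]
        exact (mem_filter.1 (hts ha)).2
      refine ⟨t ∪ {v}, union_subset (hts.trans (filter_subset _ _))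
        (singleton_subset_iff.2 hv), ht.union (T.isTransOn_singleton v) hcomp, ?_⟩
      rw [card_union_of_disjoint (T.disjoint_of_complete hcomp), card_singleton]
      omega

theorem lt_trSize_of_two_pow_le (T : Tournament n) {k : ℕ} (h : 2 ^ k ≤ n) : k < T.trSize := by
  obtain ⟨t, -, ht, htc⟩ := T.exists_transOn_of_two_pow_le k univ (by simpa using h)
  exact htc.trans (T.card_le_trSizeOn (subset_univ t) ht)

/-- A transitive set splits into `m` consecutive pieces of equal size. -/
theorem IsTransOn.exists_pieces {T : Tournament n} {S : Finset (Fin n)} (hS : T.IsTransOn S)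
    (m : ℕ) : ∃ P : Fin m → Finset (Fin n), (∀ i, P i ⊆ S ∧ (P i).card = S.card / m) ∧
      ∀ i j, i < j → ∀ a ∈ P i, ∀ b ∈ P j, T.adj a b := by
  classical
  let r : Fin n → ℕ := fun v => (S.filter (fun u => T.adj u v)).card
  have hlt : ∀ u ∈ S, ∀ v ∈ S, T.adj u v → r u < r v := by
    intro u hu v hv huv
    refine card_lt_card ((ssubset_iff_of_subset ?_).2 ⟨u, by simp [hu, huv], ?_⟩)
    · intro w hw
      rw [mem_filter] at hw ⊢
      exact ⟨hw.1, hS w hw.1 u hu v hv hw.2 huv⟩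
    · simp [T.not_adj_self]
  have hinj : Set.InjOn r S := by
    intro u hu v hv huv
    by_contra hne
    rcases T.total u v hne with h | h
    · exact (hlt u hu v hv h).ne huv
    · exact (hlt v hv u hu h).ne huv.symm
  have himg : S.image r = range S.card := by
    refine eq_of_subset_of_card_le ?_ ?_
    · intro x hx
      obtain ⟨v, hv, rfl⟩ := mem_image.1 hx
      refine mem_range.2 (card_lt_card ((ssubset_iff_of_subset (filter_subset _ _)).2
        ⟨v, hv, ?_⟩))
      simp [T.not_adj_self]
    · rw [card_image_of_injOn hinj, card_range]
  set L := S.card / m with hL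
  refine ⟨fun i => S.filter (fun v => r v ∈ Ico (i.val * L) ((i.val + 1) * L)),
    fun i => ⟨filter_subset _ _, ?_⟩, ?_⟩
  · rw [← card_image_of_injOn (hinj.mono (coe_subset.2 (filter_subset _ _)))]
    have : (S.filter (fun v => r v ∈ Ico (i.val * L) ((i.val + 1) * L))).image r
        = Ico (i.val * L) ((i.val + 1) * L) := by
      ext x
      simp only [mem_image, mem_filter]
      constructor
      · rintro ⟨v, ⟨-, hv⟩, rfl⟩
        exact hv
      · intro hx
        have hxS : x ∈ S.image r := by
          rw [himg, mem_range]
          have h1 : (i.val + 1) * L ≤ m * L := Nat.mul_le_mul_right _ i.isLt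
          have h2 : m * L ≤ S.card := Nat.mul_div_le _ _
          have h3 := (mem_Ico.1 hx).2
          omega
        obtain ⟨v, hv, rfl⟩ := mem_image.1 hxS
        exact ⟨v, ⟨hv, hx⟩, rfl⟩
    rw [this, Nat.card_Ico, Nat.add_mul]
    omega
  · intro i j hij a ha b hb
    simp only [mem_filter, mem_Ico] at ha hb
    have h1 : (i.val + 1) * L ≤ j.val * L := Nat.mul_le_mul_right _ hij
    have hab : r a < r b := by omega
    have hne : a ≠ b := by
      rintro rfl
      exact lt_irrefl _ hab
    exact (T.total a b hne).resolve_right fun h =>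
      absurd (hlt b hb.1 a ha.1 h) (by omega)

end Transitive

section Critical

variable {n : ℕ}

theorem EpsCritical.pos {T : Tournament n} {ε : ℝ} (hT : T.EpsCritical ε) (hε : 0 < ε) :
    0 < n := by
  rcases Nat.eq_zero_or_pos n with rfl | h
  · have := hT.1
    rw [Nat.cast_zero, Real.zero_rpow hε.ne'] at this
    exact absurd this (not_lt.2 (Nat.cast_nonneg _))
  · exact h

theorem EpsCritical.rpow_le {T : Tournament n} {ε c : ℝ} (hT : T.EpsCritical ε) (hε : 0 < ε)
    (hc : 0 < c) {A : Finset (Fin n)} (hA : c * n ≤ A.card) (hne : A ≠ univ) :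
    c ^ ε * (n : ℝ) ^ ε ≤ T.trSizeOn A := by
  rw [← Real.mul_rpow hc.le (Nat.cast_nonneg n)]
  exact (Real.rpow_le_rpow (by positivity) hA hε.le).trans (hT.2 A hne)

/-- In a critical tournament, there is no complete pair between a linear set and a large
transitive set. -/
theorem EpsCritical.not_complete_transOn {T : Tournament n} {ε c : ℝ} (hT : T.EpsCritical ε)
    (hε : 0 < ε) (hc : 0 < c) (hcε : 1 ≤ c ^ ε + c) {A B : Finset (Fin n)}
    (hA : c * n ≤ A.card) (hB : c * T.trSize ≤ B.card) (hBt : T.IsTransOn B)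
    (hcomp : (∀ a ∈ A, ∀ b ∈ B, T.adj a b) ∨ (∀ a ∈ A, ∀ b ∈ B, T.adj b a)) : False := by
  have hdisj : Disjoint A B := by
    rcases hcomp with h | h
    · exact T.disjoint_of_complete h
    · exact (T.disjoint_of_complete fun b hb a ha => h a ha b hb).symm
  have hsum : T.trSizeOn A + T.trSizeOn B ≤ T.trSize := by
    rcases hcomp with h | h
    · exact T.trSizeOn_add_le h
    · rw [add_comm]
      exact T.trSizeOn_add_le fun b hb a ha => h a ha b hb
  have htr : 0 < T.trSize := T.lt_trSize_of_two_pow_le (k := 0) (hT.pos hε)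
  have hne : A ≠ univ := by
    rintro rfl
    have hB0 : B = ∅ := by
      rwa [← bot_eq_empty, ← top_disjoint (a := B)]
    rw [hB0, card_empty, Nat.cast_zero] at hB
    have : 0 < c * (T.trSize : ℝ) := by positivity
    linarith
  have h1 := hT.rpow_le hε hc hA hne
  have h2 : (B.card : ℝ) ≤ T.trSizeOn B := by
    exact_mod_cast T.card_le_trSizeOn (Subset.refl B) hBt
  have h3 : (T.trSizeOn A : ℝ) + T.trSizeOn B ≤ T.trSize := by exact_mod_cast hsum
  have h4 : c ^ ε * (T.trSize : ℝ) < c ^ ε * (n : ℝ) ^ ε :=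
    mul_lt_mul_of_pos_left hT.1 (Real.rpow_pos_of_pos hc _)
  have h5 : 1 * (T.trSize : ℝ) ≤ (c ^ ε + c) * T.trSize :=
    mul_le_mul_of_nonneg_right hcε (Nat.cast_nonneg _)
  linarith

/-- In a critical tournament, there is no complete pair of linear sets. -/
theorem EpsCritical.not_complete {T : Tournament n} {ε c : ℝ} (hT : T.EpsCritical ε)
    (hε : 0 < ε) (hc : 0 < c) (hcε : 1 ≤ 2 * c ^ ε) {A B : Finset (Fin n)}
    (hA : c * n ≤ A.card) (hB : c * n ≤ B.card)
    (hcomp : ∀ a ∈ A, ∀ b ∈ B, T.adj a b) : False := by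
  have hdisj := T.disjoint_of_complete hcomp
  have hn : (0 : ℝ) < c * n := mul_pos hc (by exact_mod_cast hT.pos hε)
  have hAn : A.Nonempty := card_pos.1 (by exact_mod_cast hn.trans_le hA)
  have hBn : B.Nonempty := card_pos.1 (by exact_mod_cast hn.trans_le hB)
  have hAu : A ≠ univ := by
    rintro rfl
    obtain ⟨b, hb⟩ := hBn
    exact disjoint_left.1 hdisj (mem_univ b) hb
  have hBu : B ≠ univ := by
    rintro rfl
    obtain ⟨a, ha⟩ := hAn
    exact disjoint_left.1 hdisj ha (mem_univ a)
  have h1 := hT.rpow_le hε hc hA hAu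
  have h2 := hT.rpow_le hε hc hB hBu
  have h3 : (T.trSizeOn A : ℝ) + T.trSizeOn B ≤ T.trSize := by
    exact_mod_cast T.trSizeOn_add_le hcomp
  have h4 : 1 * (n : ℝ) ^ ε ≤ (2 * c ^ ε) * (n : ℝ) ^ ε :=
    mul_le_mul_of_nonneg_right hcε (by positivity)
  linarith [hT.1]

theorem EpsCritical.le_trSize {T : Tournament n} {ε : ℝ} (hT : T.EpsCritical ε) (hε : 0 < ε)
    {M : ℕ} (hM : ((2 : ℝ) ^ M) ^ ε < 2) : M ≤ T.trSize := by
  by_contra! hlt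
  have hn : n < 2 ^ M := by
    by_contra! h
    exact absurd (T.lt_trSize_of_two_pow_le h) (by omega)
  have h1 : (n : ℝ) ^ ε ≤ ((2 : ℝ) ^ M) ^ ε :=
    Real.rpow_le_rpow (Nat.cast_nonneg n) (by exact_mod_cast hn.le) hε.le
  have h2 : T.trSize < 2 := by exact_mod_cast (hT.1.trans_le h1).trans hM
  have h3 : n < 2 := by
    by_contra! h
    exact absurd (T.lt_trSize_of_two_pow_le (k := 1) h) (by omega)
  have h4 : (n : ℝ) ^ ε ≤ 1 :=
    Real.rpow_le_one (Nat.cast_nonneg n) (by exact_mod_cast Nat.lt_succ_iff.1 h3) hε.le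
  have h5 : T.trSize < 1 := by exact_mod_cast hT.1.trans_le h4
  exact absurd (T.lt_trSize_of_two_pow_le (k := 0) (hT.pos hε)) (by omega)

theorem exists_eps_bounds {c : ℝ} (hc : 0 < c) (M : ℕ) : ∃ ε₀ : ℝ, 0 < ε₀ ∧
    ∀ ε : ℝ, 0 < ε → ε < ε₀ → 1 ≤ c ^ ε + c ∧ 1 ≤ 2 * c ^ ε ∧ ((2 : ℝ) ^ M) ^ ε < 2 := by
  have key : ∀ a : ℝ, 0 < a → Filter.Tendsto (fun ε : ℝ => a ^ ε) (nhds 0) (nhds 1) := by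
    intro a ha
    simpa using (Real.continuous_const_rpow ha.ne').tendsto 0
  have e1 : ∀ᶠ ε : ℝ in nhds 0, 1 - c < c ^ ε := (key c hc).eventually_const_lt (by linarith)
  have e2 : ∀ᶠ ε : ℝ in nhds 0, 1 / 2 < c ^ ε := (key c hc).eventually_const_lt (by norm_num)
  have e3 : ∀ᶠ ε : ℝ in nhds 0, ((2 : ℝ) ^ M) ^ ε < 2 :=
    (key _ (by positivity)).eventually_lt_const (by norm_num)
  obtain ⟨δ, hδ, h⟩ := Metric.eventually_nhds_iff.1 (e1.and (e2.and e3))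
  refine ⟨δ, hδ, fun ε h0 h1 => ?_⟩
  obtain ⟨a, b, d⟩ := h (y := ε) (by rwa [Real.dist_0_eq_abs, abs_of_pos h0])
  exact ⟨by linarith, by linarith, d⟩

end Critical

section Selection

variable {n m : ℕ}

/-- Greedy selection of one vertex from every part, unit by unit: vertices of different units
are joined by forward arcs, and the pairs related by `R` by backward arcs. -/
theorem exists_selection (T : Tournament n) {ι : Type*} (P : Fin m → Finset (Fin n))
    (U : Fin m → ι) (R : Fin m → Fin m → Prop) (hR : ∀ p p', R p p' → U p = U p')
    (hbad : ∀ p p', ∀ v ∈ P p, ∀ B ⊆ P p',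
      (∀ b ∈ B, ¬ ((p < p' → T.adj v b) ∧ (p' < p → T.adj b v))) →
        2 * m * B.card ≤ (P p').card)
    (hstep : ∀ i, ∀ P' : Fin m → Finset (Fin n),
      (∀ p, P' p ⊆ P p ∧ (P p).card ≤ 2 * (P' p).card) →
      ∃ y : Fin m → Fin n, (∀ p, U p = i → y p ∈ P' p) ∧
        ∀ p p', U p = i → R p p' → T.adj (y p') (y p)) :
    ∃ x : Fin m → Fin n, (∀ p, x p ∈ P p) ∧
      (∀ p p', p < p' → U p ≠ U p' → T.adj (x p) (x p')) ∧
      ∀ p p', R p p' → T.adj (x p') (x p) := by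
  classical
  have key : ∀ I : Finset ι, ∃ x : Fin m → Fin n, (∀ p, U p ∈ I → x p ∈ P p) ∧
      (∀ p p', U p ∈ I → U p' ∈ I → p < p' → U p ≠ U p' → T.adj (x p) (x p')) ∧
      ∀ p p', U p ∈ I → R p p' → T.adj (x p') (x p) := by
    intro I
    induction I using Finset.induction_on with
    | empty =>
      have hx : Nonempty (Fin m → Fin n) := by
        rcases Nat.eq_zero_or_pos m with rfl | hm
        · exact ⟨fun p => p.elim0⟩
        · obtain ⟨y, -⟩ := hstep (U ⟨0, hm⟩) P fun p => ⟨Subset.refl _, by omega⟩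
          exact ⟨y⟩
      exact ⟨hx.some, by simp, by simp, by simp⟩
    | insert i I hi ih =>
      obtain ⟨x, hxP, hxF, hxR⟩ := ih
      let bad : Fin m → Fin m → Finset (Fin n) := fun p₀ p =>
        (P p).filter fun b => ¬ ((p₀ < p → T.adj (x p₀) b) ∧ (p < p₀ → T.adj b (x p₀)))
      let P' : Fin m → Finset (Fin n) := fun p => (P p).filter fun b =>
        ∀ p₀, U p₀ ∈ I → (p₀ < p → T.adj (x p₀) b) ∧ (p < p₀ → T.adj b (x p₀))
      have hP' : ∀ p, P' p ⊆ P p ∧ (P p).card ≤ 2 * (P' p).card := by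
        intro p
        refine ⟨filter_subset _ _, ?_⟩
        have hsub : P p ⊆ P' p ∪ (univ.filter fun p₀ => U p₀ ∈ I).biUnion fun p₀ => bad p₀ p := by
          intro b hb
          by_cases h : b ∈ P' p
          · exact mem_union_left _ h
          · have h' : ∃ p₀, U p₀ ∈ I ∧
                ¬ ((p₀ < p → T.adj (x p₀) b) ∧ (p < p₀ → T.adj b (x p₀))) := by
              by_contra! hcon
              exact h (mem_filter.2 ⟨hb, hcon⟩)
            obtain ⟨p₀, h1, h2⟩ := h'
            exact mem_union_right _ (mem_biUnion.2
              ⟨p₀, mem_filter.2 ⟨mem_univ _, h1⟩, mem_filter.2 ⟨hb, h2⟩⟩)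
        have hc1 := (card_le_card hsub).trans (card_union_le _ _)
        have hc2 : 2 * m * ((univ.filter fun p₀ => U p₀ ∈ I).biUnion
            fun p₀ => bad p₀ p).card ≤ m * (P p).card := by
          calc _ ≤ 2 * m * ∑ p₀ ∈ univ.filter (fun p₀ => U p₀ ∈ I), (bad p₀ p).card :=
                Nat.mul_le_mul_left _ card_biUnion_le
            _ = ∑ p₀ ∈ univ.filter (fun p₀ => U p₀ ∈ I), 2 * m * (bad p₀ p).card := mul_sum _ _ _
            _ ≤ ∑ p₀ ∈ univ.filter (fun p₀ => U p₀ ∈ I), (P p).card :=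
                sum_le_sum fun p₀ hp₀ => hbad p₀ p _ (hxP p₀ (mem_filter.1 hp₀).2) _
                  (filter_subset _ _) fun b hb => (mem_filter.1 hb).2
            _ = (univ.filter fun p₀ => U p₀ ∈ I).card * (P p).card := by
                rw [sum_const, smul_eq_mul]
            _ ≤ m * (P p).card := by
                refine Nat.mul_le_mul_right _ ?_
                simpa using card_le_univ (univ.filter fun p₀ => U p₀ ∈ I)
        have hm : 0 < m := p.pos
        have hc3 : 2 * ((univ.filter fun p₀ => U p₀ ∈ I).biUnion fun p₀ => bad p₀ p).card
            ≤ (P p).card := by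
          refine Nat.le_of_mul_le_mul_left (c := m) ?_ hm
          linarith
        omega
      obtain ⟨y, hyP, hyR⟩ := hstep i P' hP'
      have hne : ∀ p, U p ∈ I → U p ≠ i := fun p hp h => hi (h ▸ hp)
      refine ⟨fun p => if U p = i then y p else x p, ?_, ?_, ?_⟩
      · intro p hp
        by_cases h : U p = i
        · simpa [h] using (hP' p).1 (hyP p h)
        · simpa [h] using hxP p ((mem_insert.1 hp).resolve_left h)
      · intro p p' hp hp' hlt hU
        by_cases h : U p = i <;> by_cases h' : U p' = i
        · exact absurd (h.trans h'.symm) hU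
        · have := (mem_filter.1 (hyP p h)).2 p' ((mem_insert.1 hp').resolve_left h')
          simpa [h, h'] using this.2 hlt
        · have := (mem_filter.1 (hyP p' h')).2 p ((mem_insert.1 hp).resolve_left h)
          simpa [h, h'] using this.1 hlt
        · simpa [h, h'] using hxF p p' ((mem_insert.1 hp).resolve_left h)
            ((mem_insert.1 hp').resolve_left h') hlt hU
      · intro p p' hp hpp'
        have hUU := hR p p' hpp'
        by_cases h : U p = i
        · have h' : U p' = i := hUU ▸ h
          simpa [h, h'] using hyR p p' h hpp'
        · have h' : U p' ≠ i := hUU ▸ h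
          simpa [h, h'] using hxR p p' ((mem_insert.1 hp).resolve_left h) hpp'
  obtain ⟨x, h1, h2, h3⟩ := key (univ.image U)
  have hmem : ∀ p, U p ∈ univ.image U := fun p => mem_image_of_mem U (mem_univ p)
  exact ⟨x, fun p => h1 p (hmem p), fun p p' => h2 p p' (hmem p) (hmem p'),
    fun p p' => h3 p p' (hmem p)⟩

/-- In a linear set placed at `p₀`, linearly many vertices have a backward arc to each of the
large transitive sets `B p`, `p ∈ F`. -/
theorem EpsCritical.exists_linear_subset {T : Tournament n} {ε d : ℝ} (hT : T.EpsCritical ε)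
    (hε : 0 < ε) (hd : 0 < d) (hdε : 1 ≤ d ^ ε + d) (B : Fin m → Finset (Fin n))
    (F : Finset (Fin m)) (p₀ : Fin m) (hF : p₀ ∉ F)
    (hA : 2 * m * d * n ≤ ((B p₀).card : ℝ))
    (hB : ∀ p ∈ F, T.IsTransOn (B p) ∧ d * T.trSize ≤ (B p).card)
    (hdisj : ∀ p ∈ F, Disjoint (B p₀) (B p)) :
    ∃ A ⊆ B p₀, d * n ≤ (A.card : ℝ) ∧ ∀ a ∈ A, ∀ p ∈ F, ∃ b ∈ B p,
      (p < p₀ → T.adj a b) ∧ (p₀ < p → T.adj b a) := by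
  classical
  let bad : Fin m → Finset (Fin n) := fun p => (B p₀).filter fun a =>
    ¬ ∃ b ∈ B p, (p < p₀ → T.adj a b) ∧ (p₀ < p → T.adj b a)
  have hbad : ∀ p ∈ F, ((bad p).card : ℝ) ≤ d * n := by
    intro p hp
    by_contra! hlt
    refine hT.not_complete_transOn hε hd hdε hlt.le (hB p hp).2 (hB p hp).1 ?_
    have hne : ∀ a ∈ bad p, ∀ b ∈ B p, a ≠ b := fun a ha b hb hab =>
      disjoint_left.1 (hdisj p hp) (mem_filter.1 ha).1 (hab ▸ hb)
    have hpp : p ≠ p₀ := fun h => hF (h ▸ hp)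
    rcases lt_or_gt_of_ne hpp with h | h
    · right
      intro a ha b hb
      refine (T.total a b (hne a ha b hb)).resolve_left fun hab => ?_
      exact (mem_filter.1 ha).2 ⟨b, hb, fun _ => hab, fun h' => absurd h' h.not_gt⟩
    · left
      intro a ha b hb
      refine (T.total a b (hne a ha b hb)).resolve_right fun hab => ?_
      exact (mem_filter.1 ha).2 ⟨b, hb, fun h' => absurd h' h.not_gt, fun _ => hab⟩
  refine ⟨(B p₀).filter fun a => ∀ p ∈ F, ∃ b ∈ B p,
    (p < p₀ → T.adj a b) ∧ (p₀ < p → T.adj b a), filter_subset _ _, ?_,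
    fun a ha => (mem_filter.1 ha).2⟩
  set A := (B p₀).filter fun a => ∀ p ∈ F, ∃ b ∈ B p,
    (p < p₀ → T.adj a b) ∧ (p₀ < p → T.adj b a) with hAdef
  have hsub : B p₀ ⊆ A ∪ F.biUnion bad := by
    intro a ha
    by_cases h : a ∈ A
    · exact mem_union_left _ h
    · have h' : ∃ p ∈ F, ¬ ∃ b ∈ B p, (p < p₀ → T.adj a b) ∧ (p₀ < p → T.adj b a) := by
        by_contra hcon
        refine h (mem_filter.2 ⟨ha, fun p hp => ?_⟩)
        by_contra hq
        exact hcon ⟨p, hp, hq⟩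
      obtain ⟨p, hp, hq⟩ := h'
      exact mem_union_right _ (mem_biUnion.2 ⟨p, hp, mem_filter.2 ⟨ha, hq⟩⟩)
  have h1 : ((B p₀).card : ℝ) ≤ A.card + ∑ p ∈ F, ((bad p).card : ℝ) := by
    have := (card_le_card hsub).trans ((card_union_le _ _).trans
      (Nat.add_le_add_left card_biUnion_le _))
    exact_mod_cast this
  have h2 : ∑ p ∈ F, ((bad p).card : ℝ) ≤ F.card * (d * n) := by
    simpa using sum_le_sum hbad
  have h3 : (F.card : ℝ) ≤ m := by
    exact_mod_cast (by simpa using card_le_univ F : F.card ≤ m)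
  have h4 : (F.card : ℝ) * (d * n) ≤ m * (d * n) :=
    mul_le_mul_of_nonneg_right h3 (by positivity)
  have h5 : (1 : ℝ) ≤ m := by exact_mod_cast p₀.pos
  have h6 : 1 * (d * (n : ℝ)) ≤ m * (d * n) := mul_le_mul_of_nonneg_right h5 (by positivity)
  linarith

/-- Realization of the backward arcs of a unit with a single center `p₀`. -/
theorem EpsCritical.exists_star {T : Tournament n} {ε d : ℝ} (hT : T.EpsCritical ε)
    (hε : 0 < ε) (hd : 0 < d) (hdε : 1 ≤ d ^ ε + d) (B : Fin m → Finset (Fin n))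
    (W : Fin m → Prop) (R : Fin m → Fin m → Prop) (hRlt : ∀ p p', R p p' → p < p')
    (p₀ : Fin m) (hA : 2 * m * d * n ≤ ((B p₀).card : ℝ))
    (hB : ∀ p, W p → p ≠ p₀ → T.IsTransOn (B p) ∧ d * T.trSize ≤ (B p).card)
    (hdisj : ∀ p, p ≠ p₀ → Disjoint (B p₀) (B p))
    (hRW : ∀ p p', R p p' → W p → W p' ∧ (p = p₀ ∨ p' = p₀)) :
    ∃ y : Fin m → Fin n, (∀ p, W p → y p ∈ B p) ∧
      ∀ p p', W p → R p p' → T.adj (y p') (y p) := by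
  classical
  obtain ⟨A, hAs, hAc, hAb⟩ := hT.exists_linear_subset hε hd hdε B
    (univ.filter fun p => W p ∧ p ≠ p₀) p₀ (by simp) hA
    (fun p hp => hB p (mem_filter.1 hp).2.1 (mem_filter.1 hp).2.2)
    (fun p hp => hdisj p (mem_filter.1 hp).2.2)
  have hn : (0 : ℝ) < d * n := mul_pos hd (by exact_mod_cast hT.pos hε)
  obtain ⟨a, ha⟩ : A.Nonempty := card_pos.1 (by exact_mod_cast hn.trans_le hAc)
  have hsel : ∀ p, ∃ b, (p = p₀ → b = a) ∧ (W p → p ≠ p₀ → b ∈ B p ∧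
      (p < p₀ → T.adj a b) ∧ (p₀ < p → T.adj b a)) := by
    intro p
    by_cases h : W p ∧ p ≠ p₀
    · obtain ⟨b, hb, hb'⟩ := hAb a ha p (mem_filter.2 ⟨mem_univ _, h⟩)
      exact ⟨b, fun h' => absurd h' h.2, fun _ _ => ⟨hb, hb'⟩⟩
    · exact ⟨a, fun _ => rfl, fun h1 h2 => absurd ⟨h1, h2⟩ h⟩
  choose y hy0 hy using hsel
  refine ⟨y, fun p hp => ?_, fun p p' hp hpp' => ?_⟩
  · by_cases h : p = p₀
    · rw [hy0 p h, h]
      exact hAs ha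
    · exact (hy p hp h).1
  · have hlt := hRlt p p' hpp'
    obtain ⟨hp', rfl | rfl⟩ := hRW p p' hpp' hp
    · rw [hy0 p rfl]
      exact (hy p' hp' hlt.ne').2.2 hlt
    · rw [hy0 p' rfl]
      exact (hy p hp hlt.ne).2.1 hlt

/-- Realization of the backward arcs of a super middle 2-nebula with centers `p₀ < p₅` and
leaves `p₃` (attached to `p₀`) and `p₂` (attached to `p₅`). -/
theorem EpsCritical.exists_nebula {T : Tournament n} {ε d : ℝ} (hT : T.EpsCritical ε)
    (hε : 0 < ε) (hd : 0 < d) (hdε : 1 ≤ d ^ ε + d) (hdε' : 1 ≤ 2 * d ^ ε)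
    (B : Fin m → Finset (Fin n)) {p₀ p₂ p₃ p₅ : Fin m} (h02 : p₀ < p₂) (h23 : p₂ < p₃)
    (h35 : p₃ < p₅) (hA₀ : 2 * m * d * n ≤ ((B p₀).card : ℝ))
    (hA₅ : 2 * m * d * n ≤ ((B p₅).card : ℝ))
    (hB₂ : T.IsTransOn (B p₂) ∧ d * T.trSize ≤ (B p₂).card)
    (hB₃ : T.IsTransOn (B p₃) ∧ d * T.trSize ≤ (B p₃).card)
    (hdisj : ∀ p p', p ≠ p' → Disjoint (B p) (B p')) :
    ∃ y : Fin m → Fin n, (y p₀ ∈ B p₀ ∧ y p₂ ∈ B p₂ ∧ y p₃ ∈ B p₃ ∧ y p₅ ∈ B p₅) ∧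
      T.adj (y p₃) (y p₀) ∧ T.adj (y p₅) (y p₂) ∧ T.adj (y p₅) (y p₀) := by
  classical
  have h03 := h02.trans h23
  have h25 := h23.trans h35
  have h05 := h02.trans h25
  obtain ⟨A₀, hs₀, hc₀, hb₀⟩ := hT.exists_linear_subset hε hd hdε B {p₃} p₀
    (by simpa using h03.ne) hA₀ (fun p hp => by rwa [mem_singleton.1 hp])
    (fun p hp => hdisj _ _ (by rw [mem_singleton.1 hp]; exact h03.ne))
  obtain ⟨A₅, hs₅, hc₅, hb₅⟩ := hT.exists_linear_subset hε hd hdε B {p₂} p₅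
    (by simpa using h25.ne') hA₅ (fun p hp => by rwa [mem_singleton.1 hp])
    (fun p hp => hdisj _ _ (by rw [mem_singleton.1 hp]; exact h25.ne'))
  have hex : ∃ a ∈ A₀, ∃ a' ∈ A₅, T.adj a' a := by
    by_contra! hcon
    refine hT.not_complete hε hd hdε' hc₀ hc₅ fun a ha a' ha' => ?_
    refine (T.total a a' ?_).resolve_right (hcon a ha a' ha')
    rintro rfl
    exact disjoint_left.1 (hdisj _ _ h05.ne) (hs₀ ha) (hs₅ ha')
  obtain ⟨a, ha, a', ha', haa'⟩ := hex
  obtain ⟨b₃, hb₃, -, hadj₃⟩ := hb₀ a ha p₃ (mem_singleton_self _)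
  obtain ⟨b₂, hb₂, hadj₂, -⟩ := hb₅ a' ha' p₂ (mem_singleton_self _)
  refine ⟨fun p => if p = p₀ then a else if p = p₂ then b₂ else if p = p₃ then b₃ else a', ?_⟩
  simp only [h02.ne', h03.ne', h23.ne', h05.ne', h25.ne', h35.ne', if_true, if_false]
  exact ⟨⟨hs₀ ha, hb₂, hb₃, hs₅ ha'⟩, hadj₃ h03, hadj₂ h25, haa'⟩

end Selection

section Smooth

variable {n : ℕ}

theorem card_not_adj_of_density_left (T : Tournament n) {lam : ℝ} {v : Fin n}
    {S B : Finset (Fin n)} (h : 1 - lam ≤ T.density {v} S) (hBS : B ⊆ S)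
    (hB : ∀ b ∈ B, ¬ T.adj v b) : (B.card : ℝ) ≤ lam * S.card := by
  classical
  have hset : {p : Fin n × Fin n | p.1 ∈ ({v} : Finset (Fin n)) ∧ p.2 ∈ S ∧ T.adj p.1 p.2}
      = ((S.filter fun b => T.adj v b).image fun b => (v, b) : Finset (Fin n × Fin n)) := by
    ext ⟨a, b⟩
    simp only [Set.mem_ofPred_eq, mem_singleton, coe_image, coe_filter, Set.mem_image,
      Prod.mk.injEq]
    constructor
    · rintro ⟨rfl, hb, hab⟩
      exact ⟨b, ⟨hb, hab⟩, rfl, rfl⟩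
    · rintro ⟨b', ⟨hb, hab⟩, rfl, rfl⟩
      exact ⟨rfl, hb, hab⟩
  rw [density, hset, Set.ncard_coe_finset,
    card_image_of_injective _ (fun x y hxy => (Prod.mk.inj hxy).2), card_singleton,
    Nat.cast_one, one_mul] at h
  have hsum : ((S.filter fun b => T.adj v b).card : ℝ) + B.card ≤ S.card := by
    rw [← Nat.cast_add, Nat.cast_le, ← card_union_of_disjoint
      (disjoint_left.2 fun b hb hb' => hB b hb' (mem_filter.1 hb).2)]
    exact card_le_card (union_subset (filter_subset _ _) hBS)
  rcases (Nat.cast_nonneg S.card : (0 : ℝ) ≤ S.card).eq_or_lt with h0 | h0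
  · have : (0 : ℝ) ≤ (S.filter fun b => T.adj v b).card := Nat.cast_nonneg _
    rw [← h0] at hsum ⊢
    linarith
  · rw [le_div_iff₀ h0] at h
    linarith

theorem card_not_adj_of_density_right (T : Tournament n) {lam : ℝ} {v : Fin n}
    {S B : Finset (Fin n)} (h : 1 - lam ≤ T.density S {v}) (hBS : B ⊆ S)
    (hB : ∀ b ∈ B, ¬ T.adj b v) : (B.card : ℝ) ≤ lam * S.card := by
  classical
  have hset : {p : Fin n × Fin n | p.1 ∈ S ∧ p.2 ∈ ({v} : Finset (Fin n)) ∧ T.adj p.1 p.2}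
      = ((S.filter fun b => T.adj b v).image fun b => (b, v) : Finset (Fin n × Fin n)) := by
    ext ⟨b, a⟩
    simp only [Set.mem_ofPred_eq, mem_singleton, coe_image, coe_filter, Set.mem_image,
      Prod.mk.injEq]
    constructor
    · rintro ⟨hb, rfl, hab⟩
      exact ⟨b, ⟨hb, hab⟩, rfl, rfl⟩
    · rintro ⟨b', ⟨hb, hab⟩, rfl, rfl⟩
      exact ⟨hb, rfl, hab⟩
  rw [density, hset, Set.ncard_coe_finset,
    card_image_of_injective _ (fun x y hxy => (Prod.mk.inj hxy).1), card_singleton,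
    Nat.cast_one, mul_one] at h
  have hsum : ((S.filter fun b => T.adj b v).card : ℝ) + B.card ≤ S.card := by
    rw [← Nat.cast_add, Nat.cast_le, ← card_union_of_disjoint
      (disjoint_left.2 fun b hb hb' => hB b hb' (mem_filter.1 hb).2)]
    exact card_le_card (union_subset (filter_subset _ _) hBS)
  rcases (Nat.cast_nonneg S.card : (0 : ℝ) ≤ S.card).eq_or_lt with h0 | h0
  · have : (0 : ℝ) ≤ (S.filter fun b => T.adj b v).card := Nat.cast_nonneg _
    rw [← h0] at hsum ⊢
    linarith
  · rw [le_div_iff₀ h0] at h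
    linarith

/-- Refinement of a smooth structure to one part for every position. -/
theorem IsSmoothStructure.exists_parts {T : Tournament n} {c lam : ℝ} {N m : ℕ}
    {w : Fin N → Bool} {S : Fin N → Finset (Fin n)} (hS : T.IsSmoothStructure c lam w S)
    {s : Fin m → Bool} {ρ : Fin m → Fin N} (hρ : Monotone ρ) (hw : ∀ p, w (ρ p) = s p)
    (hρs : ∀ p p', ρ p = ρ p' → p ≠ p' → s p = true)
    (hm : (m : ℝ) ≤ c * T.trSize) (hlam : 0 < lam) (hlam' : lam * (2 * m) ^ 2 ≤ 1) :
    ∃ P : Fin m → Finset (Fin n),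
      (∀ p, s p = false → c * n ≤ ((P p).card : ℝ)) ∧
      (∀ p, s p = true → T.IsTransOn (P p) ∧ c * T.trSize ≤ 2 * m * ((P p).card : ℝ)) ∧
      (∀ p p', p ≠ p' → Disjoint (P p) (P p')) ∧
      (∀ p p', p < p' → ρ p = ρ p' → ∀ a ∈ P p, ∀ b ∈ P p', T.adj a b) ∧
      ∀ p p', ∀ v ∈ P p, ∀ B ⊆ P p',
        (∀ b ∈ B, ¬ ((p < p' → T.adj v b) ∧ (p' < p → T.adj b v))) →
          2 * m * B.card ≤ (P p').card := by
  classical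
  obtain ⟨hdisj, hlin, htrans, hdens⟩ := hS
  have hpiece : ∀ j, ∃ P : Fin m → Finset (Fin n), w j = true →
      (∀ i, P i ⊆ S j ∧ (P i).card = (S j).card / m) ∧
      ∀ i i', i < i' → ∀ a ∈ P i, ∀ b ∈ P i', T.adj a b := by
    intro j
    by_cases h : w j = true
    · obtain ⟨P, hP⟩ := (htrans j h).1.exists_pieces m
      exact ⟨P, fun _ => hP⟩
    · exact ⟨fun _ => ∅, fun h' => absurd h' h⟩
  choose P₀ hP₀ using hpiece
  let P : Fin m → Finset (Fin n) := fun p => if s p = true then P₀ (ρ p) p else S (ρ p)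
  have hPt : ∀ p, s p = true → P p = P₀ (ρ p) p := fun p hp => if_pos hp
  have hPf : ∀ p, s p = false → P p = S (ρ p) := fun p hp => if_neg (by simp [hp])
  have hsub : ∀ p, P p ⊆ S (ρ p) := by
    intro p
    cases hp : s p
    · rw [hPf p hp]
    · rw [hPt p hp]
      exact ((hP₀ (ρ p) ((hw p).trans hp)).1 p).1
  have hcard : ∀ p, (S (ρ p)).card ≤ 2 * m * (P p).card := by
    intro p
    have hmp : 0 < m := p.pos
    cases hp : s p
    · rw [hPf p hp]
      exact Nat.le_mul_of_pos_left _ (by omega)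
    · have hwp := (hw p).trans hp
      rw [hPt p hp, ((hP₀ (ρ p) hwp).1 p).2]
      have hmS : m ≤ (S (ρ p)).card := by exact_mod_cast hm.trans (htrans _ hwp).2
      have h1 : 1 ≤ (S (ρ p)).card / m := (Nat.one_le_div_iff hmp).2 hmS
      have h2 := Nat.div_add_mod (S (ρ p)).card m
      have h3 := Nat.mod_lt (S (ρ p)).card hmp
      have h4 : m * 1 ≤ m * ((S (ρ p)).card / m) := Nat.mul_le_mul_left _ h1
      linarith
  have hcomp : ∀ p p', p < p' → ρ p = ρ p' → ∀ a ∈ P p, ∀ b ∈ P p', T.adj a b := by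
    intro p p' hlt hpp' a ha b hb
    have h1 := hρs p p' hpp' hlt.ne
    have h2 := hρs p' p hpp'.symm hlt.ne'
    rw [hPt p h1] at ha
    rw [hPt p' h2, ← hpp'] at hb
    exact (hP₀ (ρ p) ((hw p).trans h1)).2 p p' hlt a ha b hb
  refine ⟨P, ?_, ?_, ?_, hcomp, ?_⟩
  · intro p hp
    rw [hPf p hp]
    exact hlin _ ((hw p).trans hp)
  · intro p hp
    have hwp := (hw p).trans hp
    refine ⟨(htrans _ hwp).1.mono (hsub p), (htrans _ hwp).2.trans ?_⟩
    exact_mod_cast hcard p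
  · intro p p' hpp'
    by_cases hr : ρ p = ρ p'
    · rcases lt_or_gt_of_ne hpp' with h | h
      · exact T.disjoint_of_complete (hcomp p p' h hr)
      · exact (T.disjoint_of_complete (hcomp p' p h hr.symm)).symm
    · exact disjoint_of_subset_left (hsub p) (disjoint_of_subset_right (hsub p') (hdisj _ _ hr))
  · intro p p' v hv B hB hbad
    rcases B.eq_empty_or_nonempty with rfl | ⟨b₀, hb₀⟩
    · simp
    have hlam'' : (B.card : ℝ) ≤ lam * (S (ρ p')).card := by
      rcases lt_trichotomy p p' with h | h | h
      · by_cases hr : ρ p = ρ p'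
        · exact absurd ⟨fun _ => hcomp p p' h hr v hv b₀ (hB hb₀),
            fun h' => absurd h' h.not_gt⟩ (hbad b₀ hb₀)
        · refine T.card_not_adj_of_density_left
            ((hdens _ _ (lt_of_le_of_ne (hρ h.le) hr)).1 v (hsub p hv)) (hB.trans (hsub p')) ?_
          exact fun b hb hvb => hbad b hb ⟨fun _ => hvb, fun h' => absurd h' h.not_gt⟩
      · exact absurd ⟨fun h' => absurd h h'.ne, fun h' => absurd h h'.ne'⟩ (hbad b₀ hb₀)
      · by_cases hr : ρ p' = ρ p
        · exact absurd ⟨fun h' => absurd h' h.not_gt,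
            fun _ => hcomp p' p h hr b₀ (hB hb₀) v hv⟩ (hbad b₀ hb₀)
        · refine T.card_not_adj_of_density_right
            ((hdens _ _ (lt_of_le_of_ne (hρ h.le) hr)).2 v (hsub p hv)) (hB.trans (hsub p')) ?_
          exact fun b hb hvb => hbad b hb ⟨fun h' => absurd h' h.not_gt, fun _ => hvb⟩
    have h1 : ((S (ρ p')).card : ℝ) ≤ 2 * m * (P p').card := by exact_mod_cast hcard p'
    have h2 : 2 * (m : ℝ) * B.card ≤ (P p').card := by
      calc 2 * (m : ℝ) * B.card ≤ 2 * m * (lam * (2 * m * (P p').card)) := by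
              gcongr
              exact hlam''.trans (by gcongr)
        _ = lam * (2 * m) ^ 2 * (P p').card := by ring
        _ ≤ 1 * (P p').card := mul_le_mul_of_nonneg_right hlam' (Nat.cast_nonneg _)
        _ = (P p').card := one_mul _
    exact_mod_cast h2

end Smooth

section KeyTournament

variable {fz l k : ℕ} {K : Tournament fz} {β : Equiv.Perm (Fin fz)} {q : Fin l → Fin 6 → Fin fz}
  {Q : Fin k → Finset (Fin fz)} {ctr : Fin k → Fin fz}

theorem pos_apply (β : Equiv.Perm (Fin fz)) (p : Fin fz) : pos β (β p) = p :=
  β.symm_apply_apply p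

theorem mem_k6verts (β : Equiv.Perm (Fin fz)) (q : Fin 6 → Fin fz) (a : Fin 6) :
    β (q a) ∈ k6verts β q :=
  mem_image_of_mem _ (mem_univ a)

theorem exists_of_mem_k6verts {q : Fin 6 → Fin fz} {p : Fin fz} (h : β p ∈ k6verts β q) :
    ∃ a, p = q a := by
  obtain ⟨a, -, ha⟩ := mem_image.1 h
  exact ⟨a, (β.injective ha).symm⟩

theorem GK6Decomp.q_inj (hK : GK6Decomp K β q Q ctr) {i i' : Fin l} {a a' : Fin 6}
    (h : q i a = q i' a') : i = i' ∧ a = a' := by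
  obtain ⟨hq, -, hqd, -⟩ := hK
  have hi : i = i' := by
    by_contra hne
    refine disjoint_left.1 (hqd i i' hne) (mem_k6verts β (q i) a) ?_
    rw [h]
    exact mem_k6verts β (q i') a'
  subst hi
  exact ⟨rfl, (hq i).1.injective h⟩

theorem GK6Decomp.q_notMem (hK : GK6Decomp K β q Q ctr) (i : Fin l) (a : Fin 6) (j : Fin k) :
    β (q i a) ∉ Q j :=
  disjoint_left.1 (hK.2.2.2.1 i j) (mem_k6verts β (q i) a)

theorem IsFrontierStarAt.center_mem {S : Finset (Fin fz)} {c : Fin fz}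
    (h : K.IsFrontierStarAt β S c) : c ∈ S := by
  rcases h with h | h <;> exact h.1

theorem IsFrontierStarAt.not_between {S : Finset (Fin fz)} {c : Fin fz}
    (h : K.IsFrontierStarAt β S c) : ¬ BetweenSet β (S.erase c) c := by
  rintro ⟨u, hu, v, hv, huc, hcv⟩
  rcases h with h | h
  · exact (h.2.2.1 u hu).1.not_gt huc
  · exact (h.2.2.1 v hv).1.not_gt hcv

theorem IsFrontierStarAt.backward_iff {S : Finset (Fin fz)} {c u v : Fin fz}
    (h : K.IsFrontierStarAt β S c) (hu : u ∈ S) (hv : v ∈ S) (hlt : pos β u < pos β v) :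
    K.adj v u ↔ u = c ∨ v = c := by
  have hne : u ≠ v := by
    rintro rfl
    exact lt_irrefl _ hlt
  constructor
  · intro hadj
    rcases h with h | h
    · exact Or.inl (h.2.2.2 v hv u hu ⟨hadj, hlt⟩)
    · exact Or.inr (h.2.2.2 v hv u hu ⟨hadj, hlt⟩)
  · rintro (rfl | rfl)
    · rcases h with h | h
      · exact (h.2.2.1 v (mem_erase.2 ⟨hne.symm, hv⟩)).2
      · exact absurd (h.2.2.1 v (mem_erase.2 ⟨hne.symm, hv⟩)).1 hlt.not_gt
    · rcases h with h | h
      · exact absurd (h.2.2.1 u (mem_erase.2 ⟨hne, hu⟩)).1 hlt.not_gt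
      · exact (h.2.2.1 u (mem_erase.2 ⟨hne, hu⟩)).2

/-- The units of a `GK₆`: a super middle 2-nebula and a two-vertex star for every `K₆`, and the
stars of the regular galaxy. -/
theorem GK6Decomp.exists_unit (hK : GK6Decomp K β q Q ctr) :
    ∃ U : Fin fz → (Fin l × Bool) ⊕ Fin k,
      (∀ i a, U (q i a) = Sum.inl (i, decide (a = 1 ∨ a = 4))) ∧
      (∀ p j, U p = Sum.inr j ↔ β p ∈ Q j) ∧
      ∀ p i b, U p = Sum.inl (i, b) → ∃ a, p = q i a := by
  obtain ⟨-, -, -, -, hQd, hcov, -⟩ := id hK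
  have hex : ∀ p, ∃ u : (Fin l × Bool) ⊕ Fin k,
      (∃ i a, p = q i a ∧ u = Sum.inl (i, decide (a = 1 ∨ a = 4))) ∨
      ∃ j, β p ∈ Q j ∧ u = Sum.inr j := by
    intro p
    rcases hcov (β p) with ⟨i, hi⟩ | ⟨j, hj⟩
    · obtain ⟨a, ha⟩ := exists_of_mem_k6verts hi
      exact ⟨_, Or.inl ⟨i, a, ha, rfl⟩⟩
    · exact ⟨_, Or.inr ⟨j, hj, rfl⟩⟩
  choose U hU using hex
  refine ⟨U, fun i a => ?_, fun p j => ⟨fun h => ?_, fun h => ?_⟩, fun p i b h => ?_⟩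
  · rcases hU (q i a) with ⟨i', a', h, hu⟩ | ⟨j, hj, -⟩
    · obtain ⟨rfl, rfl⟩ := hK.q_inj h
      exact hu
    · exact absurd hj (hK.q_notMem i a j)
  · rcases hU p with ⟨i', a', -, hu⟩ | ⟨j', hj', hu⟩
    · rw [h] at hu
      cases hu
    · rw [h] at hu
      cases hu
      exact hj'
  · rcases hU p with ⟨i', a', rfl, -⟩ | ⟨j', hj', hu⟩
    · exact absurd h (hK.q_notMem i' a' j)
    · have : j' = j := by
        by_contra hne
        exact disjoint_left.1 (hQd j' j hne) hj' h
      rw [hu, this]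
  · rcases hU p with ⟨i', a', rfl, hu⟩ | ⟨j', -, hu⟩
    · rw [h] at hu
      cases hu
      exact ⟨a', rfl⟩
    · rw [h] at hu
      cases hu

theorem K6_adj_iff : ∀ a b : Fin 6, K6.adj a b ↔
    (a < b ∧ ¬ (a = 0 ∧ b = 3) ∧ ¬ (a = 2 ∧ b = 5) ∧ ¬ (a = 0 ∧ b = 5) ∧ ¬ (a = 1 ∧ b = 4)) ∨
    (a = 3 ∧ b = 0) ∨ (a = 5 ∧ b = 2) ∨ (a = 5 ∧ b = 0) ∨ (a = 4 ∧ b = 1) := by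
  intro a b
  change ((a.val, b.val) ∈ K6back ∨ (a < b ∧ (b.val, a.val) ∉ K6back)) ↔ _
  revert a b
  decide

theorem K6_backward {a b : Fin 6} (hlt : a < b) (h : K6.adj b a) :
    (a = 0 ∧ b = 3) ∨ (a = 2 ∧ b = 5) ∨ (a = 0 ∧ b = 5) ∨ (a = 1 ∧ b = 4) := by
  rcases (K6_adj_iff b a).1 h with h | h | h | h | h
  · exact absurd h.1 hlt.not_gt
  all_goals tauto

theorem GK6Decomp.unit_eq_of_backward (hK : GK6Decomp K β q Q ctr)
    {U : Fin fz → (Fin l × Bool) ⊕ Fin k}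
    (hUq : ∀ i a, U (q i a) = Sum.inl (i, decide (a = 1 ∨ a = 4)))
    (hUQ : ∀ p j, U p = Sum.inr j ↔ β p ∈ Q j) {p p' : Fin fz} (hlt : p < p')
    (hadj : K.adj (β p') (β p)) : U p = U p' := by
  obtain ⟨hq, -, -, -, -, -, hback, -⟩ := id hK
  rcases hback (β p') (β p) ⟨hadj, by rwa [pos_apply, pos_apply]⟩ with ⟨i, h', h⟩ | ⟨j, h', h⟩
  · obtain ⟨a, rfl⟩ := exists_of_mem_k6verts h
    obtain ⟨a', rfl⟩ := exists_of_mem_k6verts h'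
    have haa := (hq i).1.lt_iff_lt.1 hlt
    rw [hUq, hUq]
    rcases K6_backward haa (((hq i).2.2.2.2 _ _).2 hadj) with
      ⟨rfl, rfl⟩ | ⟨rfl, rfl⟩ | ⟨rfl, rfl⟩ | ⟨rfl, rfl⟩ <;> rfl
  · rw [(hUQ p j).2 h, (hUQ p' j).2 h']

variable {ch : Fin l → Fin fz} {sK : Fin fz → Bool}

theorem GK6Decomp.leaf_of_k6 (hK : GK6Decomp K β q Q ctr)
    (hch : ∀ i, ch i = β (q i 1) ∨ ch i = β (q i 4))
    (hs : ∀ p : Fin fz, sK p = false ↔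
      ((∃ j, β p = ctr j) ∨ ∃ i, β p = β (q i 0) ∨ β p = β (q i 5) ∨ β p = ch i))
    (i : Fin l) (a : Fin 6) (h0 : a ≠ 0) (h5 : a ≠ 5) (hc : β (q i a) ≠ ch i) :
    sK (q i a) = true := by
  rw [← Bool.not_eq_false]
  intro hf
  rcases (hs _).1 hf with ⟨j, hj⟩ | ⟨i', h | h | h⟩
  · exact hK.q_notMem i a j (hj ▸ (hK.2.1 j).center_mem)
  · exact h0 (hK.q_inj (β.injective h)).2
  · exact h5 (hK.q_inj (β.injective h)).2
  · have hi : i = i' := by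
      rcases hch i' with h' | h' <;> rw [h'] at h <;> exact (hK.q_inj (β.injective h)).1
    exact hc (hi ▸ h)

/-- No position between two leaves of a star is marked as a center. -/
theorem GK6Decomp.leaf_of_between (hK : GK6Decomp K β q Q ctr)
    (hch : ∀ i, ch i = β (q i 1) ∨ ch i = β (q i 4))
    (hs : ∀ p : Fin fz, sK p = false ↔
      ((∃ j, β p = ctr j) ∨ ∃ i, β p = β (q i 0) ∨ β p = β (q i 5) ∨ β p = ch i))
    {j : Fin k} {p₁ p p₂ : Fin fz} (h₁ : β p₁ ∈ (Q j).erase (ctr j))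
    (h₂ : β p₂ ∈ (Q j).erase (ctr j)) (h1p : p₁ ≤ p) (hp2 : p ≤ p₂) : sK p = true := by
  obtain ⟨hq, hstar, hqd, hqQ, hQd, hcov, hback, hcc, hcq⟩ := id hK
  have hbetw : ∀ p, p₁ < p → p < p₂ → BetweenSet β ((Q j).erase (ctr j)) (β p) :=
    fun p h h' => ⟨_, h₁, _, h₂, by rwa [pos_apply, pos_apply], by rwa [pos_apply, pos_apply]⟩
  have hctr : ∀ j', β p = ctr j' → p₁ < p ∧ p < p₂ := by
    intro j' hj'
    have hne : ∀ p', β p' ∈ (Q j).erase (ctr j) → p' ≠ p := by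
      rintro p' hp' rfl
      rw [mem_erase, hj'] at hp'
      by_cases hjj : j' = j
      · exact hp'.1 (by rw [hjj])
      · exact disjoint_left.1 (hQd j' j hjj) (hstar j').center_mem hp'.2
    exact ⟨lt_of_le_of_ne h1p (hne p₁ h₁), lt_of_le_of_ne hp2 (hne p₂ h₂).symm⟩
  have hqne : ∀ i a p', β p' ∈ (Q j).erase (ctr j) → p' ≠ q i a := by
    rintro i a p' hp' rfl
    exact hK.q_notMem i a j (mem_erase.1 hp').2
  rw [← Bool.not_eq_false]
  intro hf
  rcases (hs _).1 hf with ⟨j', hj'⟩ | ⟨i, h | h | h⟩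
  · have hb := hbetw p (hctr j' hj').1 (hctr j' hj').2
    rw [hj'] at hb
    by_cases hjj : j' = j
    · rw [hjj] at hb
      exact (hstar j).not_between hb
    · exact hcc j' j hjj hb
  · obtain rfl := β.injective h
    exact (hcq i j).1 (hbetw _ (lt_of_le_of_ne h1p (hqne i 0 p₁ h₁))
      (lt_of_le_of_ne hp2 (hqne i 0 p₂ h₂).symm))
  · obtain rfl := β.injective h
    exact (hcq i j).2 (hbetw _ (lt_of_le_of_ne h1p (hqne i 5 p₁ h₁))
      (lt_of_le_of_ne hp2 (hqne i 5 p₂ h₂).symm))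
  · have hv := (hq i).2.1
    have hv' := (hq i).2.2.2.1
    rcases hch i with h' | h' <;> rw [h'] at h <;> obtain rfl := β.injective h
    · have hlt := lt_of_le_of_ne h1p (hqne i 1 p₁ h₁)
      have hn : p₁.val ≠ (q i 0).val := fun h => hqne i 0 p₁ h₁ (Fin.ext h)
      refine (hcq i j).1 (hbetw _ ?_ ?_) <;> rw [Fin.lt_def] at * <;> rw [Fin.le_def] at * <;>
        omega
    · have hlt := lt_of_le_of_ne hp2 (hqne i 4 p₂ h₂).symm
      have hn : p₂.val ≠ (q i 5).val := fun h => hqne i 5 p₂ h₂ (Fin.ext h)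
      refine (hcq i j).2 (hbetw _ ?_ ?_) <;> rw [Fin.lt_def] at * <;> rw [Fin.le_def] at * <;>
        omega

theorem eq_block_of_forall_leaf {Nw : ℕ} {ρ : Fin fz → Fin Nw}
    (hρ : ∀ (p : Fin fz) (hp : p.val + 1 < fz), sK p = true → sK ⟨p.val + 1, hp⟩ = true →
      ρ p = ρ ⟨p.val + 1, hp⟩) {p₁ p₂ : Fin fz} (hle : p₁ ≤ p₂)
    (hleaf : ∀ p, p₁ ≤ p → p ≤ p₂ → sK p = true) : ρ p₁ = ρ p₂ := by
  have key : ∀ d (hd : p₁.val + d < fz), p₁.val + d ≤ p₂.val → ρ p₁ = ρ ⟨p₁.val + d, hd⟩ := by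
    intro d
    induction d with
    | zero => intro _ _; rfl
    | succ d ih =>
      intro hd hd2
      rw [ih (by omega) (by omega)]
      refine hρ ⟨p₁.val + d, by omega⟩ hd (hleaf _ ?_ ?_) (hleaf _ ?_ ?_) <;>
        rw [Fin.le_def] <;> simp only <;> omega
  have := key (p₂.val - p₁.val) (by rw [Fin.le_def] at hle; omega) (by rw [Fin.le_def] at hle; omega)
  rw [this]
  congr 1
  ext
  rw [Fin.le_def] at hle
  simp only
  omega

theorem KeyCorr.card_le {h : ℕ} {H : Tournament h} {θ : Equiv.Perm (Fin h)} {φ : Fin h → Fin fz}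
    (hkey : KeyCorr H θ K β q φ) (hK : GK6Decomp K β q Q ctr) : fz ≤ 2 * h := by
  classical
  obtain ⟨-, -, hrange, -⟩ := hkey
  let kept : Fin 3 → Fin 6 := ![0, 3, 5]
  let del : Fin 3 → Fin 6 := ![1, 2, 4]
  have hpre : ∀ z : Fin l × Fin 3, ∃ u, φ u = β (q z.1 (kept z.2)) := by
    rintro ⟨i, a⟩
    refine (hrange _).2 fun i' => ?_
    fin_cases a <;> refine ⟨fun h => ?_, fun h => ?_, fun h => ?_⟩ <;>
      exact absurd (hK.q_inj (β.injective h)).2 (by simp [kept])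
  choose g hg using hpre
  have hginj : Function.Injective g := by
    rintro ⟨i, a⟩ ⟨i', a'⟩ hz
    have h1 := (hg ⟨i, a⟩).symm.trans ((congrArg φ hz).trans (hg ⟨i', a'⟩))
    obtain ⟨rfl, h2⟩ := hK.q_inj (β.injective h1)
    have hkept : Function.Injective kept := by decide
    exact Prod.ext rfl (hkept h2)
  have hl : l * 3 ≤ h := by
    simpa using Fintype.card_le_of_injective g hginj
  have hcov : (univ : Finset (Fin fz)) ⊆
      univ.image φ ∪ univ.image fun z : Fin l × Fin 3 => β (q z.1 (del z.2)) := by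
    intro x _
    by_cases hx : ∃ u, φ u = x
    · obtain ⟨u, rfl⟩ := hx
      exact mem_union_left _ (mem_image_of_mem _ (mem_univ u))
    · rw [hrange] at hx
      push Not at hx
      obtain ⟨i, hi⟩ := hx
      refine mem_union_right _ ?_
      by_cases h1 : x = β (q i 1)
      · exact mem_image.2 ⟨(i, 0), mem_univ _, h1.symm⟩
      · by_cases h2 : x = β (q i 2)
        · exact mem_image.2 ⟨(i, 1), mem_univ _, h2.symm⟩
        · exact mem_image.2 ⟨(i, 2), mem_univ _, (hi h1 h2).symm⟩
  have h1 := (card_le_card hcov).trans ((card_union_le _ _).trans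
    (Nat.add_le_add card_image_le card_image_le))
  simp only [card_univ, Fintype.card_fin, Fintype.card_prod] at h1
  omega

end KeyTournament

section Realization

variable {h fz l k n : ℕ} {H : Tournament h} {θ : Equiv.Perm (Fin h)} {K : Tournament fz}
  {β : Equiv.Perm (Fin fz)} {q : Fin l → Fin 6 → Fin fz} {Q : Fin k → Finset (Fin fz)}
  {ctr : Fin k → Fin fz} {φ : Fin h → Fin fz}

theorem K6_adj_cases {a b : Fin 6} (hab : K6.adj a b) :
    b < a ∨ (a < b ∧ decide (a = 1 ∨ a = 4) ≠ decide (b = 1 ∨ b = 4)) ∨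
      (a = 0 ∧ b = 2) ∨ (a = 2 ∧ b = 3) ∨ (a = 3 ∧ b = 5) := by
  rw [K6_adj_iff] at hab
  revert a b
  decide

/-- If `x` realizes `K` except possibly for the arcs of each `K₆` joining its first and third
and its fourth and sixth vertices, then `T` contains `H` or `K₆`. -/
theorem GK6Decomp.contains_of_realization (hK : GK6Decomp K β q Q ctr)
    (hkey : KeyCorr H θ K β q φ) (T : Tournament n) {U : Fin fz → (Fin l × Bool) ⊕ Fin k}
    (hUq : ∀ i a, U (q i a) = Sum.inl (i, decide (a = 1 ∨ a = 4)))
    (hUQ : ∀ p j, U p = Sum.inr j ↔ β p ∈ Q j)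
    (hUi : ∀ p i b, U p = Sum.inl (i, b) → ∃ a, p = q i a) (x : Fin fz → Fin n)
    (hx : Function.Injective x)
    (hF : ∀ p p', p < p' → U p ≠ U p' → T.adj (x p) (x p'))
    (hB : ∀ p p', p < p' → K.adj (β p') (β p) → T.adj (x p') (x p))
    (hstar : ∀ j p p', p < p' → β p ∈ Q j → β p' ∈ Q j → K.adj (β p) (β p') →
      T.adj (x p) (x p'))
    (h23 : ∀ i, T.adj (x (q i 2)) (x (q i 3))) : T.Contains H ∨ T.Contains K6 := by
  classical
  have hq := hK.1
  have hmono : ∀ i, StrictMono (q i) := fun i => (hq i).1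
  have hKadj : ∀ i a b, K6.adj a b ↔ K.adj (β (q i a)) (β (q i b)) := fun i => (hq i).2.2.2.2
  have hBq : ∀ i a b, b < a → K6.adj a b → T.adj (x (q i a)) (x (q i b)) :=
    fun i a b hlt hab => hB _ _ (hmono i hlt) ((hKadj i a b).1 hab)
  have b30 : K6.adj 3 0 := by rw [K6_adj_iff]; decide
  have b52 : K6.adj 5 2 := by rw [K6_adj_iff]; decide
  have b50 : K6.adj 5 0 := by rw [K6_adj_iff]; decide
  have f35 : K6.adj 3 5 := by rw [K6_adj_iff]; decide
  have hq3 : ∀ i i' a, q i 3 = q i' a → i = i' ∧ a = 3 := fun i i' a h =>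
    ⟨(hK.q_inj h).1, (hK.q_inj h).2.symm⟩
  by_cases hex : ∃ i, T.adj (x (q i 0)) (x (q i 2)) ∧ T.adj (x (q i 3)) (x (q i 5))
  · obtain ⟨i, h02, h35⟩ := hex
    refine Or.inr (T.contains_of_hom K6 (fun a => x (q i a)) fun a b hab => ?_)
    rcases K6_adj_cases hab with hlt | ⟨hlt, hne⟩ | ⟨rfl, rfl⟩ | ⟨rfl, rfl⟩ | ⟨rfl, rfl⟩
    · exact hBq i a b hlt hab
    · refine hF _ _ (hmono i hlt) fun hU => hne ?_
      rw [hUq, hUq] at hU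
      exact (Prod.mk.inj (Sum.inl.inj hU)).2
    · exact h02
    · exact h23 i
    · exact h35
  left
  have hσ : ∀ i, ∃ a : Fin 6, (a = 2 ∨ a = 3) ∧ T.adj (x (q i a)) (x (q i 0)) ∧
      T.adj (x (q i 5)) (x (q i a)) := by
    intro i
    have hne : ∀ a b : Fin 6, a ≠ b → x (q i a) ≠ x (q i b) := fun a b hab h =>
      hab ((hmono i).injective (hx h))
    by_cases h02 : T.adj (x (q i 0)) (x (q i 2))
    · exact ⟨3, Or.inr rfl, hBq i 3 0 (by decide) b30,
        (T.total _ _ (hne 3 5 (by decide))).resolve_left fun h35 => hex ⟨i, h02, h35⟩⟩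
    · exact ⟨2, Or.inl rfl, (T.total _ _ (hne 0 2 (by decide))).resolve_left h02,
        hBq i 5 2 (by decide) b52⟩
  choose σ hσ23 hσ0 hσ5 using hσ
  have hτ : ∀ p, ∃ p', (∀ i, p = q i 3 → p' = q i (σ i)) ∧ ((∀ i, p ≠ q i 3) → p' = p) := by
    intro p
    by_cases hp : ∃ i, p = q i 3
    · obtain ⟨i, rfl⟩ := hp
      refine ⟨q i (σ i), fun i' hi' => ?_, fun hp => absurd rfl (hp i)⟩
      rw [(hq3 i i' 3 hi').1]
    · exact ⟨p, fun i hi => absurd ⟨i, hi⟩ hp, fun _ => rfl⟩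
  choose τ hτ3 hτne using hτ
  have hτU : ∀ p, U (τ p) = U p ∧ τ p ≤ p ∧ p.val ≤ (τ p).val + 1 := by
    intro p
    by_cases hp : ∃ i, p = q i 3
    · obtain ⟨i, rfl⟩ := hp
      have hv := (hq i).2.2.1
      rw [hτ3 _ i rfl, hUq, hUq, Fin.le_def]
      rcases hσ23 i with h2 | h2 <;> rw [h2]
      · exact ⟨rfl, by omega, by omega⟩
      · exact ⟨rfl, le_refl _, by omega⟩
    · rw [hτne p fun i hi => hp ⟨i, hi⟩]
      exact ⟨rfl, le_refl _, by omega⟩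
  have hτq : ∀ i a, a ≠ 3 → τ (q i a) = q i a := fun i a ha =>
    hτne _ fun i' h' => ha (hK.q_inj h').2
  have hcross : ∀ p p', U p ≠ U p' → K.adj (β p) (β p') → T.adj (x (τ p)) (x (τ p')) := by
    intro p p' hU hadj
    have hlt : p < p' := by
      by_contra hle
      have hne : p' ≠ p := by
        rintro rfl
        exact hU rfl
      exact hU (hK.unit_eq_of_backward hUq hUQ (lt_of_le_of_ne (not_lt.1 hle) hne) hadj).symm
    have h1 := hτU p
    have h2 := hτU p'
    have hU' : U (τ p) ≠ U (τ p') := by rwa [h1.1, h2.1]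
    refine hF _ _ (lt_of_le_of_ne ?_ fun h => hU' (by rw [h])) hU'
    have h3 := h1.2.1
    rw [Fin.lt_def] at hlt
    rw [Fin.le_def] at h3 ⊢
    omega
  obtain ⟨-, -, hrange, hadjH⟩ := hkey
  have hkeep : ∀ u i a, φ u = β (q i a) → a = 0 ∨ a = 3 ∨ a = 5 := by
    intro u i a hu
    obtain ⟨h1, h2, h4⟩ := (hrange (φ u)).1 ⟨u, rfl⟩ i
    fin_cases a
    · decide
    · exact absurd hu h1
    · exact absurd hu h2
    · decide
    · exact absurd hu h4
    · decide
  refine T.contains_of_hom H (fun u => x (τ (β.symm (φ u)))) fun u v huv => ?_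
  obtain ⟨p, hp⟩ : ∃ p, φ u = β p := ⟨β.symm (φ u), (β.apply_symm_apply _).symm⟩
  obtain ⟨p', hp'⟩ : ∃ p, φ v = β p := ⟨β.symm (φ v), (β.apply_symm_apply _).symm⟩
  simp only [hp, hp', Equiv.symm_apply_apply]
  by_cases hflip : ∃ i, (φ u = β (q i 5) ∧ φ v = β (q i 3)) ∨
      (φ u = β (q i 3) ∧ φ v = β (q i 5))
  · have hadj := ((hadjH u v).1 hflip).1 huv
    obtain ⟨i, ⟨hu, hv⟩ | ⟨hu, hv⟩⟩ := hflip
    · rw [hp] at hu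
      rw [hp'] at hv
      rw [β.injective hu, β.injective hv, hτq i 5 (by decide), hτ3 _ i rfl]
      exact hσ5 i
    · rw [hu, hv] at hadj
      exact absurd hadj (K.asymm _ _ ((hKadj i 3 5).1 f35))
  · have hadj := ((hadjH u v).2 hflip).1 huv
    rw [hp, hp'] at hadj
    by_cases hU : U p = U p'
    · rcases hUp : U p with ⟨i, b⟩ | j
      · obtain ⟨a, rfl⟩ := hUi p i b hUp
        obtain ⟨a', rfl⟩ := hUi p' i b (hU ▸ hUp)
        have hK6 := (hKadj i a a').2 hadj
        have h35 : ¬ (a = 3 ∧ a' = 5) := by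
          rintro ⟨rfl, rfl⟩
          exact hflip ⟨i, Or.inr ⟨hp, hp'⟩⟩
        have h53 : ¬ (a = 5 ∧ a' = 3) := by
          rintro ⟨rfl, rfl⟩
          exact hflip ⟨i, Or.inl ⟨hp, hp'⟩⟩
        have hcases : (a = 3 ∧ a' = 0) ∨ (a = 5 ∧ a' = 0) := by
          rw [K6_adj_iff] at hK6
          rcases hkeep u i a hp with rfl | rfl | rfl <;>
            rcases hkeep v i a' hp' with rfl | rfl | rfl <;> revert hK6 h35 h53 <;> decide
        rcases hcases with ⟨rfl, rfl⟩ | ⟨rfl, rfl⟩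
        · rw [hτq i 0 (by decide), hτ3 _ i rfl]
          exact hσ0 i
        · rw [hτq i 0 (by decide), hτq i 5 (by decide)]
          exact hBq i 5 0 (by decide) b50
      · have hj := (hUQ p j).1 hUp
        have hj' := (hUQ p' j).1 (hU ▸ hUp)
        rw [hτne p fun i hi => hK.q_notMem i 3 j (hi ▸ hj),
          hτne p' fun i hi => hK.q_notMem i 3 j (hi ▸ hj')]
        rcases lt_trichotomy p p' with hlt | rfl | hlt
        · exact hstar j p p' hlt hj hj' hadj
        · exact absurd hadj (K.not_adj_self _)
        · exact hB p' p hlt hadj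
    · exact hcross p p' hU hadj

variable {ch : Fin l → Fin fz} {sK : Fin fz → Bool}

/-- A smooth structure corresponding to `K` in a critical tournament realizes `K`, except
possibly for the arcs of each `K₆` joining its first and third and its fourth and sixth
vertices. -/
theorem GK6Decomp.exists_realization (hK : GK6Decomp K β q Q ctr)
    (hch : ∀ i, ch i = β (q i 1) ∨ ch i = β (q i 4))
    (hs : ∀ p : Fin fz, sK p = false ↔
      ((∃ j, β p = ctr j) ∨ ∃ i, β p = β (q i 0) ∨ β p = β (q i 5) ∨ β p = ch i))
    {U : Fin fz → (Fin l × Bool) ⊕ Fin k}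
    (hUq : ∀ i a, U (q i a) = Sum.inl (i, decide (a = 1 ∨ a = 4)))
    (hUQ : ∀ p j, U p = Sum.inr j ↔ β p ∈ Q j)
    (hUi : ∀ p i b, U p = Sum.inl (i, b) → ∃ a, p = q i a)
    {Nw : ℕ} {w : Fin Nw → Bool} (hw : IsContraction sK w) {lam c d ε : ℝ} (hd : 0 < d)
    (hdc : 4 * fz * d = c) (hfz : 0 < fz) (hlam : 0 < lam) (hlam' : lam * (2 * fz) ^ 2 ≤ 1)
    (hε : 0 < ε) (hdε : 1 ≤ d ^ ε + d) (hdε' : 1 ≤ 2 * d ^ ε) {T : Tournament n}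
    (hT : T.EpsCritical ε) (hfc : (fz : ℝ) ≤ c * T.trSize) {S : Fin Nw → Finset (Fin n)}
    (hS : T.IsSmoothStructure c lam w S) :
    ∃ x : Fin fz → Fin n, Function.Injective x ∧
      (∀ p p', p < p' → U p ≠ U p' → T.adj (x p) (x p')) ∧
      (∀ p p', p < p' → K.adj (β p') (β p) → T.adj (x p') (x p)) ∧
      (∀ j p p', p < p' → β p ∈ Q j → β p' ∈ Q j → K.adj (β p) (β p') →
        T.adj (x p) (x p')) ∧
      ∀ i, T.adj (x (q i 2)) (x (q i 3)) := by
  classical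
  obtain ⟨ρ, hρm, -, hwρ, hρs, hρ1⟩ := hw
  obtain ⟨P, hlin, htr, hdisj, hcomp, hbad⟩ :=
    hS.exists_parts hρm hwρ hρs hfc hlam hlam'
  have hq := hK.1
  have hfr := hK.2.1
  have hmono : ∀ i, StrictMono (q i) := fun i => (hq i).1
  have hK6 : ∀ i a b, b < a → K.adj (β (q i a)) (β (q i b)) →
      (b = 0 ∧ a = 3) ∨ (b = 2 ∧ a = 5) ∨ (b = 0 ∧ a = 5) ∨ (b = 1 ∧ a = 4) :=
    fun i a b hlt hab => K6_backward hlt (((hq i).2.2.2.2 a b).2 hab)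
  have hleaf := hK.leaf_of_k6 hch hs
  have hchne : ∀ i a, a = 2 ∨ a = 3 → β (q i a) ≠ ch i := by
    intro i a ha h
    rcases hch i with h' | h' <;> rw [h'] at h <;>
      have h2 := (hmono i).injective (β.injective h) <;> subst h2 <;> revert ha <;> decide
  have hs2 : ∀ i, sK (q i 2) = true := fun i =>
    hleaf i 2 (by decide) (by decide) (hchne i 2 (Or.inl rfl))
  have hs3 : ∀ i, sK (q i 3) = true := fun i =>
    hleaf i 3 (by decide) (by decide) (hchne i 3 (Or.inr rfl))
  have hsub : ∀ P' : Fin fz → Finset (Fin n),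
      (∀ p, P' p ⊆ P p ∧ (P p).card ≤ 2 * (P' p).card) →
      (∀ p, sK p = false → 2 * fz * d * n ≤ ((P' p).card : ℝ)) ∧
      (∀ p, sK p = true → T.IsTransOn (P' p) ∧ d * T.trSize ≤ (P' p).card) ∧
      ∀ p p', p ≠ p' → Disjoint (P' p) (P' p') := by
    intro P' hP'
    have hcard : ∀ p, ((P p).card : ℝ) ≤ 2 * (P' p).card := fun p => by
      exact_mod_cast (hP' p).2
    refine ⟨fun p hp => ?_, fun p hp => ⟨(htr p hp).1.mono (hP' p).1, ?_⟩, fun p p' hpp' =>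
      disjoint_of_subset_left (hP' p).1 (disjoint_of_subset_right (hP' p').1 (hdisj p p' hpp'))⟩
    · have h1 := (hlin p hp).trans (hcard p)
      rw [← hdc] at h1
      linarith
    · have hf : (0 : ℝ) < fz := by exact_mod_cast hfz
      have h1 := (htr p hp).2
      have h2 : 2 * fz * ((P p).card : ℝ) ≤ 2 * fz * (2 * (P' p).card) :=
        mul_le_mul_of_nonneg_left (hcard p) (by positivity)
      rw [← hdc] at h1
      refine le_of_mul_le_mul_left (a := 4 * (fz : ℝ)) ?_ (by positivity)
      linarith
  obtain ⟨x, hxP, hxF, hxB⟩ := T.exists_selection P U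
    (fun p p' => p < p' ∧ K.adj (β p') (β p))
    (fun p p' hpp' => hK.unit_eq_of_backward hUq hUQ hpp'.1 hpp'.2) hbad (by
      intro i P' hP'
      obtain ⟨hA, hB, hD⟩ := hsub P' hP'
      rcases i with ⟨i, b⟩ | j
      · cases b
        · obtain ⟨y, ⟨y0, y2, y3, y5⟩, y30, y52, y50⟩ := hT.exists_nebula hε hd hdε hdε' P'
            (hmono i (by decide : (0 : Fin 6) < 2)) (hmono i (by decide : (2 : Fin 6) < 3))
            (hmono i (by decide : (3 : Fin 6) < 5))
            (hA _ ((hs _).2 (Or.inr ⟨i, Or.inl rfl⟩)))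
            (hA _ ((hs _).2 (Or.inr ⟨i, Or.inr (Or.inl rfl)⟩)))
            (hB _ (hs2 i)) (hB _ (hs3 i)) hD
          refine ⟨y, fun p hp => ?_, fun p p' hp hpp' => ?_⟩
          · obtain ⟨a, rfl⟩ := hUi p i _ hp
            rw [hUq] at hp
            have ha : ∀ a : Fin 6, decide (a = 1 ∨ a = 4) = false →
                a = 0 ∨ a = 2 ∨ a = 3 ∨ a = 5 := by decide
            rcases ha a (Prod.mk.inj (Sum.inl.inj hp)).2 with rfl | rfl | rfl | rfl <;> assumption
          · have hp' := (hK.unit_eq_of_backward hUq hUQ hpp'.1 hpp'.2).symm.trans hp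
            obtain ⟨a, rfl⟩ := hUi p i _ hp
            obtain ⟨a', rfl⟩ := hUi p' i _ hp'
            rcases hK6 i a' a ((hmono i).lt_iff_lt.1 hpp'.1) hpp'.2 with
              ⟨rfl, rfl⟩ | ⟨rfl, rfl⟩ | ⟨rfl, rfl⟩ | ⟨rfl, rfl⟩
            · exact y30
            · exact y52
            · exact y50
            · rw [hUq] at hp
              exact absurd (Prod.mk.inj (Sum.inl.inj hp)).2 (by decide)
        · obtain ⟨a₀, ha₀, hc₀⟩ : ∃ a₀ : Fin 6, (a₀ = 1 ∨ a₀ = 4) ∧ ch i = β (q i a₀) := by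
            rcases hch i with h | h
            · exact ⟨1, Or.inl rfl, h⟩
            · exact ⟨4, Or.inr rfl, h⟩
          have hU14 : ∀ p, U p = Sum.inl (i, true) → ∃ a : Fin 6, (a = 1 ∨ a = 4) ∧ p = q i a := by
            intro p hp
            obtain ⟨a, rfl⟩ := hUi p i _ hp
            rw [hUq] at hp
            exact ⟨a, of_decide_eq_true (Prod.mk.inj (Sum.inl.inj hp)).2, rfl⟩
          refine hT.exists_star hε hd hdε P' (fun p => U p = Sum.inl (i, true)) _
            (fun p p' h => h.1) (q i a₀) (hA _ ((hs _).2 (Or.inr ⟨i, Or.inr (Or.inr hc₀.symm)⟩)))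
            (fun p hp hne => hB p ?_) (fun p hp => hD _ _ hp.symm) fun p p' hpp' hp => ?_
          · obtain ⟨a, ha, rfl⟩ := hU14 p hp
            refine hleaf i a ?_ ?_ ?_
            · rintro rfl
              revert ha
              decide
            · rintro rfl
              revert ha
              decide
            · rw [hc₀]
              exact fun h => hne (β.injective h)
          · have hp' := (hK.unit_eq_of_backward hUq hUQ hpp'.1 hpp'.2).symm.trans hp
            refine ⟨hp', ?_⟩
            obtain ⟨a, ha, rfl⟩ := hU14 p hp
            obtain ⟨a', ha', rfl⟩ := hU14 p' hp'
            have hlt := (hmono i).lt_iff_lt.1 hpp'.1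
            rcases ha₀ with rfl | rfl <;> rcases ha with rfl | rfl <;> rcases ha' with rfl | rfl <;>
              first
                | exact Or.inl rfl
                | exact Or.inr rfl
                | exact absurd hlt (lt_irrefl _)
      · refine hT.exists_star hε hd hdε P' (fun p => U p = Sum.inr j) _
          (fun p p' h => h.1) (β.symm (ctr j))
          (hA _ ((hs _).2 (Or.inl ⟨j, β.apply_symm_apply _⟩)))
          (fun p hp hne => hB p ?_) (fun p hp => hD _ _ hp.symm) fun p p' hpp' hp => ?_
        · have hpe : β p ∈ (Q j).erase (ctr j) := mem_erase.2
            ⟨fun h => hne (by rw [← h, β.symm_apply_apply]), (hUQ p j).1 hp⟩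
          exact hK.leaf_of_between hch hs hpe hpe le_rfl le_rfl
        · have hp' := (hK.unit_eq_of_backward hUq hUQ hpp'.1 hpp'.2).symm.trans hp
          refine ⟨hp', ?_⟩
          have := ((hfr j).backward_iff ((hUQ p j).1 hp) ((hUQ p' j).1 hp')
            (by simpa only [pos_apply] using hpp'.1)).1 hpp'.2
          rwa [← β.eq_symm_apply, ← β.eq_symm_apply] at this)
  refine ⟨x, fun p p' h => ?_, hxF, fun p p' h h' => hxB p p' ⟨h, h'⟩, ?_, fun i => ?_⟩
  · by_contra hne
    exact disjoint_left.1 (hdisj p p' hne) (hxP p) (h ▸ hxP p')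
  · intro j p p' hlt hp hp' hadj
    have hnb := mt ((hfr j).backward_iff hp hp' (by simpa only [pos_apply] using hlt)).2
      (K.asymm _ _ hadj)
    have hpe : β p ∈ (Q j).erase (ctr j) := mem_erase.2 ⟨fun h => hnb (Or.inl h), hp⟩
    have hpe' : β p' ∈ (Q j).erase (ctr j) := mem_erase.2 ⟨fun h => hnb (Or.inr h), hp'⟩
    exact hcomp p p' hlt (eq_block_of_forall_leaf hρ1 hlt.le fun r h1 h2 =>
      hK.leaf_of_between hch hs hpe hpe' h1 h2) _ (hxP p) _ (hxP p')
  · have h23 := hmono i (by decide : (2 : Fin 6) < 3)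
    have hv := (hq i).2.2.1
    refine hcomp _ _ h23 (eq_block_of_forall_leaf hρ1 h23.le fun r h1 h2 => ?_) _ (hxP _) _ (hxP _)
    rw [Fin.le_def] at h1 h2
    rcases Nat.lt_or_ge r.val (q i 3).val with h | h
    · rw [show r = q i 2 from Fin.ext (by omega)]
      exact hs2 i
    · rw [show r = q i 3 from Fin.ext (by omega)]
      exact hs3 i

end Realization

end Tournament

theorem stmt14 {h fz : ℕ} (H : Tournament h) (θ : Equiv.Perm (Fin h))
    -- H is a regular central triangular galaxy under θ:
    {lt kH : ℕ} (A B C : Fin lt → Fin h) (QH : Fin kH → Finset (Fin h))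
    (ctrH : Fin kH → Fin h)
    (hH : TriGalaxyDecomp H θ A B C QH ctrH (fun i => ({A i, C i} : Finset (Fin h))))
    (hHreg : ∀ v, (∃ i, v ∈ ({A i, B i, C i} : Finset (Fin h))) ∨ ∃ j, v ∈ QH j)
    -- K under β is the key tournament corresponding to H under θ:
    (K : Tournament fz) (β : Equiv.Perm (Fin fz))
    {l k : ℕ} (q : Fin l → Fin 6 → Fin fz) (Q : Fin k → Finset (Fin fz))
    (ctr : Fin k → Fin fz)
    (hK : GK6Decomp K β q Q ctr)
    (φ : Fin h → Fin fz) (hkey : KeyCorr H θ K β q φ)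
    -- chosen centers of the two-vertex stars {v₂, v₅} of the K₆'s:
    (ch : Fin l → Fin fz) (hch : ∀ i, ch i = β (q i 1) ∨ ch i = β (q i 4))
    -- the vector s^{K,β}: 0 exactly at chosen centers of stars and centers of K₆'s:
    (sK : Fin fz → Bool)
    (hs : ∀ p : Fin fz, sK p = false ↔
      ((∃ j, β p = ctr j) ∨ ∃ i, β p = β (q i 0) ∨ β p = β (q i 5) ∨ β p = ch i))
    -- w is the contraction of s^{K,β}:
    {Nw : ℕ} (w : Fin Nw → Bool) (hw : IsContraction sK w)
    (lam c : ℝ) (hlam0 : 0 < lam) (hlam : lam < 1 / (4 * (h : ℝ)) ^ (h + 4)) (hc : 0 < c) :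
    ∃ ε₀ : ℝ, 0 < ε₀ ∧ ∀ ε : ℝ, 0 < ε → ε < ε₀ → ∀ (n : ℕ) (T : Tournament n),
      T.EpsCritical ε →
      (∃ S : Fin Nw → Finset (Fin n), T.IsSmoothStructure c lam w S) →
      T.Contains H ∨ T.Contains K6 := by
  have hh : 0 < h := by
    rcases Nat.eq_zero_or_pos h with rfl | hh
    · simp only [Nat.cast_zero, mul_zero] at hlam
      rw [zero_pow (by omega), div_zero] at hlam
      exact absurd hlam hlam0.not_gt
    · exact hh
  have hfz : 0 < fz := (φ ⟨0, hh⟩).pos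
  have hcard : (fz : ℝ) ≤ 2 * h := by exact_mod_cast hkey.card_le hK
  have hhR : (1 : ℝ) ≤ h := by exact_mod_cast hh
  have hfR : (0 : ℝ) < fz := by exact_mod_cast hfz
  have hlam' : lam * (2 * fz) ^ 2 ≤ 1 := by
    have h1 : (2 * (fz : ℝ)) ^ 2 ≤ (4 * (h : ℝ)) ^ (h + 4) :=
      (pow_le_pow_left₀ (by positivity) (by linarith) 2).trans
        (pow_le_pow_right₀ (by linarith) (by omega))
    have h2 : lam * (4 * (h : ℝ)) ^ (h + 4) ≤ 1 :=
      ((lt_div_iff₀ (by positivity)).1 hlam).le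
    exact (mul_le_mul_of_nonneg_left h1 hlam0.le).trans h2
  have hd : 0 < c / (4 * fz) := by positivity
  obtain ⟨M, hM⟩ := exists_nat_ge ((fz : ℝ) / c)
  obtain ⟨ε₀, hε₀, hbd⟩ := exists_eps_bounds hd M
  obtain ⟨U, hUq, hUQ, hUi⟩ := hK.exists_unit
  refine ⟨ε₀, hε₀, ?_⟩
  rintro ε hε hεlt n T hT ⟨S, hS⟩
  obtain ⟨hb1, hb2, hb3⟩ := hbd ε hε hεlt
  have hMtr : (M : ℝ) ≤ T.trSize := by exact_mod_cast hT.le_trSize hε hb3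
  have hfc : (fz : ℝ) ≤ c * T.trSize := by
    rw [mul_comm]
    exact (div_le_iff₀ hc).1 (hM.trans hMtr)
  obtain ⟨x, hx, hF, hB, hst, h23⟩ := hK.exists_realization hch hs hUq hUQ hUi hw hd
    (by field_simp) hfz hlam0 hlam' hε hb1 hb2 hT hfc hS
  exact hK.contains_of_realization hkey T hUq hUQ hUi x hx hF hB hst h23
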